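/- Let (b_i, σ_i², ν_i), i = 1,2, be Lévy triplets with σ_i > 0, let t > 0, and let μ_t^i be the probability measure on ℝ with characteristic function u ↦ exp(t(iub_i − u²σ_i²/2 + ∫(e^{iux} − 1 − iux·1_{|x|≤1}) ν_i(dx))); assume μ_t^i has finite first absolute moment m_i = ∫|x| dμ_t^i. For any Σ ∈ (0, min(σ_1, σ_2)) let μ̃_t^i be the probability measure with characteristic function u ↦ exp(t(iub_i − u²(σ_i² − Σ²)/2 + ∫(e^{iux} − 1 − iux·1_{|x|≤1}) ν_i(dx))). Then ‖μ_t^1 − μ_t^2‖_TV ≤ max(m_1, m_2)^{1/3} · T_1(μ̃_t^1, μ̃_t^2)^{2/3} / ((16π)^{1/6} · Σ · √t). -/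

import Mathlib

open MeasureTheory ProbabilityTheory
open scoped ENNReal NNReal

/-- Wasserstein "distance" of order `p` with respect to a cost function `c`,
with values in `ℝ≥0∞`: the infimum over all couplings `π` of `μ` and `ν` of
`(∫ c(x,y)^p dπ)^(1/p)`. -/
noncomputable def wassersteinCost {E : Type*} [MeasurableSpace E]
    (c : E → E → ℝ) (p : ℝ) (μ ν : Measure E) : ℝ≥0∞ :=
  ⨅ π ∈ {π : Measure (E × E) |
      IsProbabilityMeasure π ∧ π.map Prod.fst = μ ∧ π.map Prod.snd = ν},
    (∫⁻ z, ENNReal.ofReal (c z.1 z.2) ^ p ∂π) ^ (1 / p)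

/-- Wasserstein distance of order `p` between measures on `ℝ` (usual metric). -/
noncomputable def wasserstein (p : ℝ) (μ ν : Measure ℝ) : ℝ≥0∞ :=
  wassersteinCost (fun x y => |x - y|) p μ ν

/-- Characteristic function of a measure on `ℝ`. -/
noncomputable def charFn (μ : Measure ℝ) (u : ℝ) : ℂ :=
  ∫ x, Complex.exp ((u * x : ℝ) * Complex.I) ∂μ

/-- Toscani–Fourier distance of order `s`, with values in `ℝ≥0∞`. -/
noncomputable def toscani (s : ℝ) (μ ν : Measure ℝ) : ℝ≥0∞ :=
  ⨆ u : {u : ℝ // u ≠ 0}, ENNReal.ofReal (‖charFn μ u.1 - charFn ν u.1‖ / |u.1| ^ s)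

/-- Total variation distance between two measures. -/
noncomputable def tvDist {α : Type*} [MeasurableSpace α] (μ ν : Measure α) : ℝ :=
  ⨆ A : {A : Set α // MeasurableSet A}, |(μ A.1).toReal - (ν A.1).toReal|

/-- Convolution of two measures on `ℝ`. -/
noncomputable def mconv (μ ν : Measure ℝ) : Measure ℝ :=
  (μ.prod ν).map (fun z => z.1 + z.2)

/-- The Poisson distribution with mean `lam`, as a measure on `ℕ`. -/
noncomputable def poissonNat (lam : ℝ) : Measure ℕ :=
  Measure.sum fun k : ℕ =>
    ENNReal.ofReal (Real.exp (-lam) * lam ^ k / (Nat.factorial k)) • Measure.dirac k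

/-- The Poisson distribution with mean `lam`, as a measure on `ℝ`. -/
noncomputable def poissonReal (lam : ℝ) : Measure ℝ :=
  Measure.sum fun k : ℕ =>
    ENNReal.ofReal (Real.exp (-lam) * lam ^ k / (Nat.factorial k)) • Measure.dirac (k : ℝ)

/-- `f'` is a weak derivative of `f` on `ℝ`. -/
def IsWeakDeriv (f f' : ℝ → ℝ) : Prop :=
  ∀ φ : ℝ → ℝ, ContDiff ℝ (⊤ : ℕ∞) φ → HasCompactSupport φ →
    ∫ x, f x * deriv φ x = -∫ x, f' x * φ x

/-- The integrand of the Lévy–Khintchine exponent with truncation `1`. -/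
noncomputable def lkIntegrand (u x : ℝ) : ℂ :=
  Complex.exp ((u * x : ℝ) * Complex.I) - 1 -
    (if |x| ≤ 1 then ((u * x : ℝ) : ℂ) * Complex.I else 0)

/-- The integrand of the Lévy–Khintchine exponent fully compensated (for small jumps). -/
noncomputable def lkIntegrandC (u x : ℝ) : ℂ :=
  Complex.exp ((u * x : ℝ) * Complex.I) - 1 - ((u * x : ℝ) : ℂ) * Complex.I


lemma gm_int (n : ℕ) {c : ℝ} (hc : 0 < c) :
    Integrable (fun u : ℝ => u ^ n * Real.exp (-c * u ^ 2)) := by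
  have h := integrable_rpow_mul_exp_neg_mul_sq hc (s := (n : ℝ)) (by
    have : (0 : ℝ) ≤ n := Nat.cast_nonneg n
    linarith)
  simpa [Real.rpow_natCast] using h

lemma gm_succ (k : ℕ) {c : ℝ} (hc : 0 < c) :
    ∫ u : ℝ, u ^ (2 * k + 2) * Real.exp (-c * u ^ 2)
      = (2 * k + 1) / (2 * c) * ∫ u : ℝ, u ^ (2 * k) * Real.exp (-c * u ^ 2) := by
  have hd : ∀ u : ℝ, HasDerivAt (fun u : ℝ => u ^ (2 * k + 1) * Real.exp (-c * u ^ 2))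
      ((2 * k + 1) * (u ^ (2 * k) * Real.exp (-c * u ^ 2))
        - 2 * c * (u ^ (2 * k + 2) * Real.exp (-c * u ^ 2))) u := by
    intro u
    have h1 := (hasDerivAt_pow (2 * k + 1) u)
    have h2 : HasDerivAt (fun u : ℝ => Real.exp (-c * u ^ 2))
        (Real.exp (-c * u ^ 2) * (-c * (2 * u))) u := by
      have := ((hasDerivAt_pow 2 u).const_mul (-c)).exp
      simpa using this
    have h3 := h1.mul h2
    refine h3.congr_deriv ?_
    push_cast
    ring
  have hi1 := (gm_int (2 * k) hc).const_mul (2 * (k : ℝ) + 1)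
  have hi2 := (gm_int (2 * k + 2) hc).const_mul (2 * c)
  have h := integral_eq_zero_of_hasDerivAt_of_integrable hd (hi1.sub hi2) (gm_int (2 * k + 1) hc)
  rw [integral_sub hi1 hi2, integral_const_mul, integral_const_mul] at h
  rw [div_mul_eq_mul_div, eq_div_iff (by positivity)]
  linarith

lemma gm_zero {c : ℝ} :
    ∫ u : ℝ, u ^ (2 * 0) * Real.exp (-c * u ^ 2) = √(Real.pi / c) := by
  simpa using integral_gaussian c

lemma gm_two {c : ℝ} (hc : 0 < c) :
    ∫ u : ℝ, u ^ 2 * Real.exp (-c * u ^ 2) = 1 / (2 * c) * √(Real.pi / c) := by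
  have := gm_succ 0 hc
  rw [gm_zero] at this
  simpa using this

/-- signs and tent algebra -/
lemma sign_alg {s0 s1 s2 a b c : ℝ} (h0 : s0 = 1 ∨ s0 = -1) (h1 : s1 = 1 ∨ s1 = -1)
    (h2 : s2 = 1 ∨ s2 = -1) (ha : 0 ≤ a) (hb : 0 ≤ b) (hc : 0 ≤ c) :
    s0 * a * (s1 * b) + s1 * b * (s2 * c) - s0 * a * (s2 * c) - b ^ 2
      + 1 / 2 * (s0 * s1 * (b ^ 2 - a ^ 2)) + 1 / 2 * (s1 * s2 * (b ^ 2 - c ^ 2))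
      ≤ 1 / 2 * |2 * b - a - c| * (a + c) := by
  have hm1 : 0 ≤ (a + c) * (|2 * b - a - c| - (2 * b - a - c)) :=
    mul_nonneg (by linarith) (by linarith [le_abs_self (2 * b - a - c)])
  have hm2 : 0 ≤ (a + c) * (|2 * b - a - c| + (2 * b - a - c)) :=
    mul_nonneg (by linarith) (by linarith [neg_abs_le (2 * b - a - c)])
  rcases h0 with rfl | rfl <;> rcases h1 with rfl | rfl <;> rcases h2 with rfl | rfl <;>
    nlinarith [mul_nonneg ha hb, mul_nonneg hb hc, mul_nonneg ha hc, sq_nonneg (b - a),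
      sq_nonneg (b - c), sq_nonneg (2 * b - a - c), sq_nonneg (2 * b - a + c),
      sq_nonneg (2 * b + a - c), sq_nonneg (a - c), sq_nonneg b, sq_nonneg (b+a-c),
      sq_nonneg (b-a+c)]

/-- unnormalised tent -/
noncomputable def Lam (d x : ℝ) : ℝ := max 0 (d - |x|)

lemma Lam_nonneg (d x : ℝ) : 0 ≤ Lam d x := le_max_left _ _

lemma Lam_neg (d x : ℝ) : Lam d (-x) = Lam d x := by simp [Lam]

lemma Lam_le {d : ℝ} (hd : 0 ≤ d) (x : ℝ) : Lam d x ≤ d := by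
  unfold Lam
  exact max_le hd (by linarith [abs_nonneg x])

lemma Lam_cont (d : ℝ) : Continuous (Lam d) := by
  unfold Lam
  fun_prop

lemma Lam_supp {d x : ℝ} (h : x ∉ Set.Icc (-d) d) : Lam d x = 0 := by
  unfold Lam
  apply max_eq_left
  by_contra h'
  apply h
  rw [Set.mem_Icc, ← abs_le]
  linarith

lemma Lam_hcs (d : ℝ) : HasCompactSupport (Lam d) :=
  HasCompactSupport.intro isCompact_Icc (fun _ h => Lam_supp h)

lemma Lam_cases (d x : ℝ) : (Lam d x = 0 ∧ d ≤ |x|) ∨ (Lam d x = d - |x| ∧ |x| ≤ d) := by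
  unfold Lam
  rcases le_total d |x| with h | h
  · left; exact ⟨max_eq_left (by linarith), h⟩
  · right; exact ⟨max_eq_right (by linarith), h⟩

lemma tent_kappa {R d x : ℝ} (hd : 0 ≤ d) (hdR : d ≤ R) (hx : 0 ≤ x) :
    2 * Lam R x - Lam R (x - d) - Lam R (x + d) = 2 * Lam d x - Lam d (x - R) := by
  have hx' : |x| = x := abs_of_nonneg hx
  have hxd : |x + d| = x + d := abs_of_nonneg (by linarith)
  rcases Lam_cases R x with h1 | h1 <;> rcases Lam_cases R (x - d) with h2 | h2 <;>
  rcases Lam_cases R (x + d) with h3 | h3 <;> rcases Lam_cases d x with h4 | h4 <;>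
  rcases Lam_cases d (x - R) with h5 | h5 <;>
  rcases abs_cases (x - d) with h6 | h6 <;> rcases abs_cases (x - R) with h7 | h7 <;>
  rw [h1.1, h2.1, h3.1, h4.1, h5.1] <;> linarith [h1.2, h2.2, h3.2, h4.2, h5.2, h6.1, h6.2, h7.1, h7.2]

lemma tent_S1 {R d x : ℝ} (hd : 0 ≤ d) (hdR : d ≤ R) (hx : 0 ≤ x) :
    Lam d x * (Lam R (x - d) + Lam R (x + d)) ≤ Lam d x * (2 * R - d) := by
  have hx' : |x| = x := abs_of_nonneg hx
  have hxd : |x + d| = x + d := abs_of_nonneg (by linarith)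
  rcases Lam_cases d x with h4 | h4
  · rw [h4.1]; simp
  · apply mul_le_mul_of_nonneg_left _ (Lam_nonneg _ _)
    rcases Lam_cases R (x - d) with h2 | h2 <;>
    rcases Lam_cases R (x + d) with h3 | h3 <;>
    rcases abs_cases (x - d) with h6 | h6 <;>
    rw [h2.1, h3.1] <;> linarith [h2.2, h3.2, h4.2, h6.1, h6.2]

lemma tent_S2 {R d x : ℝ} (hd : 0 ≤ d) (hx : 0 ≤ x) :
    Lam d (x - R) * (Lam R (x - d) + Lam R (x + d)) ≤ Lam d (x - R) * (d + R - x) := by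
  have hxd : |x + d| = x + d := abs_of_nonneg (by linarith)
  rcases Lam_cases d (x - R) with h4 | h4
  · rw [h4.1]; simp
  · apply mul_le_mul_of_nonneg_left _ (Lam_nonneg _ _)
    rcases Lam_cases R (x - d) with h2 | h2 <;>
    rcases Lam_cases R (x + d) with h3 | h3 <;>
    rcases abs_cases (x - d) with h6 | h6 <;> rcases abs_cases (x - R) with h7 | h7 <;>
    rw [h2.1, h3.1] <;> linarith [h2.2, h3.2, h4.2, h6.1, h6.2, h7.1, h7.2]

lemma tent_pt_nonneg {R d x : ℝ} (hd : 0 ≤ d) (hdR : d ≤ R) (hx : 0 ≤ x) :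
    1 / 2 * |2 * Lam R x - Lam R (x - d) - Lam R (x + d)| * (Lam R (x - d) + Lam R (x + d))
      ≤ Lam d x * (2 * R - d) + 1 / 2 * (Lam d (x - R) * (d + R - x))
        + 1 / 2 * (Lam d (x + R) * (d + R + x)) := by
  rw [tent_kappa hd hdR hx]
  have h1 := tent_S1 hd hdR hx
  have h2 := tent_S2 (R := R) hd hx
  have hS : 0 ≤ Lam R (x - d) + Lam R (x + d) := add_nonneg (Lam_nonneg _ _) (Lam_nonneg _ _)
  have h3 : |2 * Lam d x - Lam d (x - R)| ≤ 2 * Lam d x + Lam d (x - R) := by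
    rw [abs_le]
    constructor <;> linarith [Lam_nonneg d x, Lam_nonneg d (x - R)]
  have h4 : 0 ≤ Lam d (x + R) * (d + R + x) := mul_nonneg (Lam_nonneg _ _) (by linarith)
  have h5 := mul_le_mul_of_nonneg_right h3 hS
  nlinarith

lemma tent_pt {R d : ℝ} (hd : 0 ≤ d) (hdR : d ≤ R) (x : ℝ) :
    1 / 2 * |2 * Lam R x - Lam R (x - d) - Lam R (x + d)| * (Lam R (x - d) + Lam R (x + d))
      ≤ Lam d x * (2 * R - d) + 1 / 2 * (Lam d (x - R) * (d + R - x))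
        + 1 / 2 * (Lam d (x + R) * (d + R + x)) := by
  rcases le_total 0 x with hx | hx
  · exact tent_pt_nonneg hd hdR hx
  · have h := tent_pt_nonneg hd hdR (x := -x) (by linarith)
    have e1 : Lam R (-x - d) = Lam R (x + d) := by rw [← Lam_neg]; congr 1; ring
    have e2 : Lam R (-x + d) = Lam R (x - d) := by rw [← Lam_neg]; congr 1; ring
    have e3 : Lam d (-x - R) = Lam d (x + R) := by rw [← Lam_neg]; congr 1; ring
    have e4 : Lam d (-x + R) = Lam d (x - R) := by rw [← Lam_neg]; congr 1; ring
    rw [e1, e2, e3, e4, Lam_neg, Lam_neg] at h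
    have e5 : 2 * Lam R x - Lam R (x + d) - Lam R (x - d)
      = 2 * Lam R x - Lam R (x - d) - Lam R (x + d) := by ring
    rw [e5] at h
    nlinarith [h]

lemma Lam_int (d : ℝ) : Integrable (Lam d) :=
  (Lam_cont d).integrable_of_hasCompactSupport (Lam_hcs d)

lemma Lam_pow_int {d : ℝ} (hd : 0 ≤ d) (n : ℕ) (hn : n ≠ 0) :
    ∫ x, Lam d x ^ n = 2 * d ^ (n + 1) / (n + 1) := by
  have h1 : ∀ x, Lam d x ^ n = (fun y => max 0 (d - y) ^ n) |x| := fun x => rfl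
  simp_rw [h1]
  rw [integral_comp_abs (f := fun y => max 0 (d - y) ^ n)]
  have h2 : ∫ x in Set.Ioi (0 : ℝ), max 0 (d - x) ^ n = ∫ x in Set.Ioc 0 d, (d - x) ^ n := by
    rw [setIntegral_eq_of_subset_of_forall_sdiff_eq_zero measurableSet_Ioi
      (s := Set.Ioc 0 d) (f := fun x => max 0 (d - x) ^ n) (fun x hx => hx.1)]
    · apply setIntegral_congr_fun measurableSet_Ioc
      intro x hx
      simp only
      rw [max_eq_right (by linarith [hx.2])]
    · intro x hx
      have : d < x := by
        by_contra h
        exact hx.2 ⟨hx.1, by linarith⟩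
      rw [max_eq_left (by linarith), zero_pow hn]
  rw [h2, ← intervalIntegral.integral_of_le hd,
    intervalIntegral.integral_comp_sub_left (fun x => x ^ n)]
  simp
  ring

lemma Lam_integral {d : ℝ} (hd : 0 ≤ d) : ∫ x, Lam d x = d ^ 2 := by
  have := Lam_pow_int hd 1 one_ne_zero
  simp only [pow_one] at this
  rw [this]; norm_num

lemma Lam_sq_integral {d : ℝ} (hd : 0 ≤ d) : ∫ x, Lam d x ^ 2 = 2 * d ^ 3 / 3 := by
  rw [Lam_pow_int hd 2 two_ne_zero]; norm_num

lemma Lam_first (d : ℝ) : ∫ x, Lam d x * x = 0 := by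
  have h := integral_neg_eq_self (fun x => Lam d x * x) volume
  simp only [Lam_neg, mul_neg, integral_neg] at h
  linarith

lemma tent_err {R d : ℝ} (hR : 0 < R) (hd : 0 ≤ d) :
    ∫ x, 1 / 2 * |2 * Lam R x - Lam R (x - d) - Lam R (x + d)| * (Lam R (x - d) + Lam R (x + d))
      ≤ 2 * d ^ 2 * R := by
  have hI : ∀ a c : ℝ, Integrable (fun x => Lam c (x + a)) := fun a c =>
    (Lam_int c).comp_add_right a
  have hI' : ∀ a c : ℝ, Integrable (fun x => Lam c (x - a)) := fun a c =>
    (Lam_int c).comp_sub_right a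
  have hsum : Integrable (fun x => R * (Lam R (x - d) + Lam R (x + d))) :=
    ((hI' d R).add (hI d R)).const_mul R
  have hbd : ∀ x, 1 / 2 * |2 * Lam R x - Lam R (x - d) - Lam R (x + d)| *
      (Lam R (x - d) + Lam R (x + d)) ≤ R * (Lam R (x - d) + Lam R (x + d)) := by
    intro x
    apply mul_le_mul_of_nonneg_right _ (add_nonneg (Lam_nonneg _ _) (Lam_nonneg _ _))
    have : |2 * Lam R x - Lam R (x - d) - Lam R (x + d)| ≤ 2 * R := by
      rw [abs_le]
      constructor <;> linarith [Lam_nonneg R x, Lam_nonneg R (x - d), Lam_nonneg R (x + d),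
        Lam_le hR.le x, Lam_le hR.le (x - d), Lam_le hR.le (x + d)]
    linarith
  have hnn : ∀ x, 0 ≤ 1 / 2 * |2 * Lam R x - Lam R (x - d) - Lam R (x + d)| *
      (Lam R (x - d) + Lam R (x + d)) := fun x =>
    mul_nonneg (by positivity) (add_nonneg (Lam_nonneg _ _) (Lam_nonneg _ _))
  rcases le_total d R with hdR | hdR
  · have hJ : Integrable (fun z => Lam d z * z) := by
      apply Continuous.integrable_of_hasCompactSupport
      · exact (Lam_cont d).mul continuous_id
      · exact (Lam_hcs d).mul_right
    have hA : Integrable (fun z => Lam d z * (d - z)) := by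
      have := ((Lam_int d).const_mul d).sub hJ
      refine this.congr (Filter.Eventually.of_forall fun z => ?_)
      simp only [Pi.sub_apply]; ring
    have hB : Integrable (fun z => Lam d z * (d + z)) := by
      have := ((Lam_int d).const_mul d).add hJ
      refine this.congr (Filter.Eventually.of_forall fun z => ?_)
      simp only [Pi.add_apply]; ring
    have vA : ∫ z, Lam d z * (d - z) = d ^ 3 := by
      have : ∀ z, Lam d z * (d - z) = d * Lam d z - Lam d z * z := fun z => by ring
      simp_rw [this]
      rw [integral_sub ((Lam_int d).const_mul d) hJ, integral_const_mul, Lam_integral hd,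
        Lam_first]
      ring
    have vB : ∫ z, Lam d z * (d + z) = d ^ 3 := by
      have : ∀ z, Lam d z * (d + z) = d * Lam d z + Lam d z * z := fun z => by ring
      simp_rw [this]
      rw [integral_add ((Lam_int d).const_mul d) hJ, integral_const_mul, Lam_integral hd,
        Lam_first]
      ring
    have hA' : Integrable (fun x => Lam d (x - R) * (d + R - x)) := by
      refine (hA.comp_sub_right R).congr (Filter.Eventually.of_forall fun z => ?_)
      simp only; ring
    have hB' : Integrable (fun x => Lam d (x + R) * (d + R + x)) := by
      refine (hB.comp_add_right R).congr (Filter.Eventually.of_forall fun z => ?_)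
      simp only; ring
    have vA' : ∫ x, Lam d (x - R) * (d + R - x) = d ^ 3 := by
      rw [← vA, ← integral_sub_right_eq_self (fun z => Lam d z * (d - z)) R]
      congr 1; ext x; ring
    have vB' : ∫ x, Lam d (x + R) * (d + R + x) = d ^ 3 := by
      rw [← vB, ← integral_add_right_eq_self (fun z => Lam d z * (d + z)) R]
      congr 1; ext x; ring
    have hfull := (((Lam_int d).mul_const (2 * R - d)).add (hA'.const_mul (1 / 2))).add
      (hB'.const_mul (1 / 2))
    calc _ ≤ ∫ x, (Lam d x * (2 * R - d) + 1 / 2 * (Lam d (x - R) * (d + R - x))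
        + 1 / 2 * (Lam d (x + R) * (d + R + x))) :=
          integral_mono_of_nonneg (Filter.Eventually.of_forall hnn) hfull
            (Filter.Eventually.of_forall (tent_pt hd hdR))
      _ = 2 * d ^ 2 * R := by
          have e1 := integral_add (((Lam_int d).mul_const (2 * R - d)).add (hA'.const_mul (1 / 2)))
            (hB'.const_mul (1 / 2))
          have e2 := integral_add ((Lam_int d).mul_const (2 * R - d)) (hA'.const_mul (1 / 2))
          simp only [Pi.add_apply] at e1 e2
          rw [e1, e2, integral_mul_const, integral_const_mul, integral_const_mul, vA', vB',
            Lam_integral hd]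
          ring
  · calc _ ≤ ∫ x, R * (Lam R (x - d) + Lam R (x + d)) :=
          integral_mono_of_nonneg (Filter.Eventually.of_forall hnn) hsum
            (Filter.Eventually.of_forall hbd)
      _ = 2 * R ^ 2 * R := by
          rw [integral_const_mul, integral_add (hI' d R) (hI d R), integral_sub_right_eq_self,
            integral_add_right_eq_self, Lam_integral hR.le]
          ring
      _ ≤ _ := by gcongr

/-- cut-off sign function -/
noncomputable def gg (s : ℝ → ℝ) (R x : ℝ) : ℝ := s x * Lam R x

/-- autocorrelation -/
noncomputable def AC (s : ℝ → ℝ) (R d : ℝ) : ℝ := ∫ x, gg s R x * gg s R (x + d)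

lemma sgn_abs {a : ℝ} (h : a = 1 ∨ a = -1) : |a| = 1 := by
  rcases h with rfl | rfl <;> simp

lemma bdd_mul_int {w f : ℝ → ℝ} (hw : Measurable w) (hb : ∀ x, |w x| ≤ 1) (hf : Integrable f) :
    Integrable (fun x => w x * f x) :=
  hf.bdd_mul hw.aestronglyMeasurable (Filter.Eventually.of_forall fun x => by
    simpa [Real.norm_eq_abs] using hb x)

lemma LamLam_int (R a b : ℝ) : Integrable (fun x => Lam R (x + a) * Lam R (x + b)) := by
  apply Continuous.integrable_of_hasCompactSupport
  · have := Lam_cont R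
    fun_prop
  · apply HasCompactSupport.mul_right
    exact (Lam_hcs R).comp_homeomorph (Homeomorph.addRight a)

lemma AC_neg (s : ℝ → ℝ) (R d : ℝ) : AC s R (-d) = AC s R d := by
  unfold AC
  rw [← integral_add_right_eq_self _ d]
  congr 1
  ext x
  rw [show x + d + -d = x by ring]
  ring

lemma AC_ineq_nonneg {s : ℝ → ℝ} (hs : Measurable s) (hs1 : ∀ x, s x = 1 ∨ s x = -1)
    {R d : ℝ} (hR : 0 < R) (hd : 0 ≤ d) :
    2 * AC s R d - AC s R (2 * d) ≤ 2 * R ^ 3 / 3 + 2 * d ^ 2 * R := by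
  have hw : ∀ a b : ℝ, Measurable (fun x => s (x + a) * s (x + b)) := fun a b => by fun_prop
  have hw1 : ∀ a b x : ℝ, |s (x + a) * s (x + b)| ≤ 1 := fun a b x => by
    rw [abs_mul, sgn_abs (hs1 _), sgn_abs (hs1 _)]; norm_num
  have hI : ∀ a b p q : ℝ, Integrable
      (fun x => s (x + a) * s (x + b) * (Lam R (x + p) * Lam R (x + q))) := fun a b p q =>
    bdd_mul_int (hw a b) (hw1 a b) (LamLam_int R p q)
  set P := fun x => s (x + -d) * s (x + 0) * (Lam R (x + -d) * Lam R (x + 0)) with hP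
  set Q := fun x => s (x + 0) * s (x + d) * (Lam R (x + 0) * Lam R (x + d)) with hQ
  set W := fun x => s (x + -d) * s (x + d) * (Lam R (x + -d) * Lam R (x + d)) with hW
  have eP : ∫ x, P x = AC s R d := by
    unfold AC
    rw [← integral_add_right_eq_self (fun x => gg s R x * gg s R (x + d)) (-d)]
    congr 1; ext x
    simp only [hP, gg, neg_add_cancel_right, add_zero]
    ring
  have eQ : ∫ x, Q x = AC s R d := by
    unfold AC
    congr 1; ext x
    simp only [hQ, gg, add_zero]
    ring
  have eW : ∫ x, W x = AC s R (2 * d) := by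
    unfold AC
    rw [← integral_add_right_eq_self (fun x => gg s R x * gg s R (x + 2 * d)) (-d)]
    congr 1; ext x
    have : x + -d + 2 * d = x + d := by ring
    simp only [hW, gg, this]
    ring
  set q := fun x => s (x + -d) * s (x + 0) * (Lam R (x + 0) * Lam R (x + 0))
    - s (x + -d) * s (x + 0) * (Lam R (x + -d) * Lam R (x + -d)) with hq
  have iq : Integrable q := (hI _ _ _ _).sub (hI _ _ _ _)
  have iq' : Integrable (fun x => q (x + d)) := iq.comp_add_right d
  have iL : Integrable (fun x => Lam R x ^ 2) := by
    simpa [sq] using LamLam_int R 0 0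
  have key : ∫ x, (P x + Q x - W x - Lam R x ^ 2 + 1 / 2 * (q x - q (x + d)))
      ≤ ∫ x, 1 / 2 * |2 * Lam R x - Lam R (x - d) - Lam R (x + d)|
        * (Lam R (x - d) + Lam R (x + d)) := by
    apply integral_mono
    · exact ((((hI _ _ _ _).add (hI _ _ _ _)).sub (hI _ _ _ _)).sub iL).add
        ((iq.sub iq').const_mul _)
    · apply Continuous.integrable_of_hasCompactSupport
      · have := Lam_cont R
        fun_prop
      · apply HasCompactSupport.mul_left
        exact ((Lam_hcs R).comp_homeomorph (Homeomorph.subRight d)).add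
          ((Lam_hcs R).comp_homeomorph (Homeomorph.addRight d))
    · intro x
      have h := sign_alg (hs1 (x - d)) (hs1 x) (hs1 (x + d)) (Lam_nonneg R (x - d))
        (Lam_nonneg R x) (Lam_nonneg R (x + d))
      simp only [hP, hQ, hW, hq, add_zero, add_neg_cancel_right, ← sub_eq_add_neg]
      refine le_trans (le_of_eq ?_) h
      ring_nf
  have e1 : ∫ x, (P x + Q x - W x - Lam R x ^ 2 + 1 / 2 * (q x - q (x + d)))
      = 2 * AC s R d - AC s R (2 * d) - 2 * R ^ 3 / 3 := by
    have iP : Integrable P := hI _ _ _ _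
    have iQ : Integrable Q := hI _ _ _ _
    have iW : Integrable W := hI _ _ _ _
    have i5 : Integrable (fun x => 1 / 2 * (q x - q (x + d))) := (iq.sub iq').const_mul _
    rw [integral_add (f := fun x => P x + Q x - W x - Lam R x ^ 2)
        (((iP.add iQ).sub iW).sub iL) i5,
      integral_sub (f := fun x => P x + Q x - W x) ((iP.add iQ).sub iW) iL,
      integral_sub (f := fun x => P x + Q x) (iP.add iQ) iW, integral_add iP iQ,
      integral_const_mul, integral_sub iq iq', integral_add_right_eq_self, eP, eQ, eW,
      Lam_sq_integral hR.le]
    ring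
  have := tent_err hR hd
  linarith

lemma AC_ineq {s : ℝ → ℝ} (hs : Measurable s) (hs1 : ∀ x, s x = 1 ∨ s x = -1)
    {R : ℝ} (hR : 0 < R) (d : ℝ) :
    2 * AC s R d - AC s R (2 * d) ≤ 2 * R ^ 3 / 3 + 2 * d ^ 2 * R := by
  rcases le_total 0 d with h | h
  · exact AC_ineq_nonneg hs hs1 hR h
  · have := AC_ineq_nonneg hs hs1 hR (d := -d) (by linarith)
    rw [AC_neg, show 2 * -d = -(2 * d) by ring, AC_neg] at this
    simpa using this

/-- Fourier transform, positive sign, of a weight w against a measure -/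
noncomputable def FTm (ρ : Measure ℝ) (w : ℝ → ℝ) (u : ℝ) : ℂ :=
  ∫ y, (w y : ℂ) * Complex.exp ((u * y : ℝ) * Complex.I) ∂ρ

noncomputable def Kc (c z : ℝ) : ℝ := √(2 * Real.pi / c) * Real.exp (-z ^ 2 / (2 * c))

lemma gauss_ft {c : ℝ} (hc : 0 < c) (z : ℝ) :
    ∫ u : ℝ, ((Real.exp (-(c / 2) * u ^ 2) : ℝ) : ℂ) * Complex.exp ((u * z : ℝ) * Complex.I)
      = (Kc c z : ℂ) := by
  have hre : 0 < ((c / 2 : ℝ) : ℂ).re := by simpa using half_pos hc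
  have h := fourierIntegral_gaussian hre (z : ℂ)
  have e1 : ∀ u : ℝ, ((Real.exp (-(c / 2) * u ^ 2) : ℝ) : ℂ) * Complex.exp ((u * z : ℝ) * Complex.I)
     = Complex.exp (Complex.I * z * u) * Complex.exp (-((c / 2 : ℝ) : ℂ) * u ^ 2) := by
    intro u
    push_cast
    rw [mul_comm]
    congr 2
    ring
  simp_rw [e1]
  rw [h]
  unfold Kc
  push_cast
  congr 1
  · rw [← Complex.ofReal_ofNat, ← Complex.ofReal_div, ← Complex.ofReal_div,
      ← Complex.ofReal_one, ← Complex.ofReal_div, ← Complex.ofReal_cpow (by positivity),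
      ← Real.sqrt_eq_rpow]
    congr 2
    field_simp
  · congr 1
    field_simp
    ring

lemma Kc_cont (c : ℝ) : Continuous (Kc c) := by
  unfold Kc
  fun_prop

lemma Kc_nonneg (c z : ℝ) : 0 ≤ Kc c z := by unfold Kc; positivity

lemma Kc_le {c : ℝ} (hc : 0 < c) (z : ℝ) : Kc c z ≤ √(2 * Real.pi / c) := by
  unfold Kc
  have : Real.exp (-z ^ 2 / (2 * c)) ≤ 1 := by
    rw [Real.exp_le_one_iff]
    apply div_nonpos_of_nonpos_of_nonneg
    · nlinarith [sq_nonneg z]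
    · positivity
  calc _ ≤ √(2 * Real.pi / c) * 1 := by gcongr
    _ = _ := mul_one _

lemma FF {ρ : Measure ℝ} [SFinite ρ] {w h : ℝ → ℝ} (hw : Integrable w ρ) (hh : Integrable h)
    {c : ℝ} (hc : 0 < c) :
    ∫ u : ℝ, ((Real.exp (-(c / 2) * u ^ 2) : ℝ) : ℂ) * (FTm ρ w u * FTm volume h (-u))
      = ((∫ z : ℝ × ℝ, w z.1 * h z.2 * Kc c (z.1 - z.2) ∂(ρ.prod volume) : ℝ) : ℂ) := by
  have e1 : ∀ u : ℝ, ((Real.exp (-(c / 2) * u ^ 2) : ℝ) : ℂ) * (FTm ρ w u * FTm volume h (-u))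
      = ∫ z : ℝ × ℝ, ((w z.1 * h z.2 : ℝ) : ℂ) * (((Real.exp (-(c / 2) * u ^ 2) : ℝ) : ℂ) *
          Complex.exp ((u * (z.1 - z.2) : ℝ) * Complex.I)) ∂(ρ.prod volume) := by
    intro u
    unfold FTm
    rw [← integral_prod_mul, ← integral_const_mul]
    congr 1
    ext z
    have : Complex.exp ((u * (z.1 - z.2) : ℝ) * Complex.I)
      = Complex.exp ((u * z.1 : ℝ) * Complex.I) * Complex.exp ((-u * z.2 : ℝ) * Complex.I) := by
      rw [← Complex.exp_add]
      congr 1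
      push_cast
      ring
    rw [this]
    push_cast
    ring
  simp_rw [e1]
  rw [integral_integral_swap]
  · rw [← integral_complex_ofReal]
    congr 1
    ext z
    rw [integral_const_mul, gauss_ft hc]
    push_cast
    ring
  · have hE : Integrable (fun u : ℝ => Real.exp (-(c / 2) * u ^ 2)) :=
      integrable_exp_neg_mul_sq (half_pos hc)
    have h1 : Integrable (fun z : ℝ × ℝ => w z.1 * h z.2) (ρ.prod volume) := hw.mul_prod hh
    have h2 : Integrable (fun q : ℝ × (ℝ × ℝ) => Real.exp (-(c / 2) * q.1 ^ 2) *
        (w q.2.1 * h q.2.2)) (volume.prod (ρ.prod volume)) := hE.mul_prod h1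
    have h3 : Integrable (fun q : ℝ × (ℝ × ℝ) =>
        Complex.exp ((q.1 * (q.2.1 - q.2.2) : ℝ) * Complex.I) *
        ((Real.exp (-(c / 2) * q.1 ^ 2) * (w q.2.1 * h q.2.2) : ℝ) : ℂ))
        (volume.prod (ρ.prod volume)) := by
      refine h2.ofReal.bdd_mul (c := 1) ?_ (Filter.Eventually.of_forall fun q => ?_)
      · exact (by fun_prop : Continuous fun q : ℝ × (ℝ × ℝ) =>
          Complex.exp ((q.1 * (q.2.1 - q.2.2) : ℝ) * Complex.I)).aestronglyMeasurable
      · rw [Complex.norm_exp_ofReal_mul_I]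
    refine h3.congr (Filter.Eventually.of_forall fun q => ?_)
    simp only [Function.uncurry]
    push_cast
    ring

lemma FTm_cont {ρ : Measure ℝ} {w : ℝ → ℝ} (hw : Integrable w ρ) : Continuous (FTm ρ w) := by
  unfold FTm
  apply continuous_of_dominated (bound := fun y => |w y|)
  · intro u
    exact hw.ofReal.aestronglyMeasurable.mul
      (by fun_prop : Continuous fun y : ℝ => Complex.exp ((u * y : ℝ) * Complex.I)).aestronglyMeasurable
  · intro u
    refine Filter.Eventually.of_forall fun y => ?_
    rw [norm_mul, Complex.norm_exp_ofReal_mul_I, Complex.norm_real, mul_one, Real.norm_eq_abs]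
  · exact hw.abs
  · refine Filter.Eventually.of_forall fun y => ?_
    fun_prop

lemma FTm_norm_le {ρ : Measure ℝ} {w : ℝ → ℝ} (u : ℝ) : ‖FTm ρ w u‖ ≤ ∫ y, |w y| ∂ρ := by
  unfold FTm
  refine (norm_integral_le_integral_norm _).trans (le_of_eq ?_)
  congr 1
  ext y
  rw [norm_mul, Complex.norm_exp_ofReal_mul_I, Complex.norm_real, mul_one, Real.norm_eq_abs]

lemma FTm_neg {ρ : Measure ℝ} {w : ℝ → ℝ} (u : ℝ) :
    FTm ρ w (-u) = (starRingEnd ℂ) (FTm ρ w u) := by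
  unfold FTm
  rw [← integral_conj]
  congr 1
  ext y
  rw [map_mul, Complex.conj_ofReal, ← Complex.exp_conj, map_mul, Complex.conj_ofReal,
    Complex.conj_I]
  congr 2
  push_cast
  ring

lemma FTm_sq {ρ : Measure ℝ} {w : ℝ → ℝ} (u : ℝ) :
    FTm ρ w u * FTm ρ w (-u) = ((‖FTm ρ w u‖ ^ 2 : ℝ) : ℂ) := by
  rw [FTm_neg, Complex.mul_conj, Complex.normSq_eq_norm_sq]

lemma gg_int {s : ℝ → ℝ} (hs : Measurable s) (hs1 : ∀ x, s x = 1 ∨ s x = -1) (R : ℝ) :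
    Integrable (gg s R) :=
  bdd_mul_int hs (fun x => (sgn_abs (hs1 x)).le) (Lam_int R)

lemma gg_abs_le {s : ℝ → ℝ} (hs1 : ∀ x, s x = 1 ∨ s x = -1) {R : ℝ} (hR : 0 < R) (x : ℝ) :
    |gg s R x| ≤ R := by
  unfold gg
  rw [abs_mul, sgn_abs (hs1 x), one_mul, abs_of_nonneg (Lam_nonneg _ _)]
  exact Lam_le hR.le x

lemma gg_meas {s : ℝ → ℝ} (hs : Measurable s) (R : ℝ) : Measurable (gg s R) := by
  unfold gg
  exact hs.mul (Lam_cont R).measurable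

lemma gexp_int {ρ : Measure ℝ} {w : ℝ → ℝ} (hw : Integrable w ρ) {c : ℝ} (hc : 0 < c) :
    Integrable (fun u : ℝ => Real.exp (-(c / 2) * u ^ 2) * ‖FTm ρ w u‖ ^ 2) := by
  have hE : Integrable (fun u : ℝ => Real.exp (-(c / 2) * u ^ 2)) :=
      integrable_exp_neg_mul_sq (half_pos hc)
  refine hE.mul_bdd (c := (∫ y, |w y| ∂ρ) ^ 2) ?_ (Filter.Eventually.of_forall fun u => ?_)
  · exact ((FTm_cont hw).norm.pow 2).aestronglyMeasurable
  · rw [norm_pow, norm_norm]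
    exact pow_le_pow_left₀ (norm_nonneg _) (FTm_norm_le u) 2

lemma Kc_int {c : ℝ} (hc : 0 < c) : Integrable (Kc c) := by
  unfold Kc
  apply Integrable.const_mul
  have := integrable_exp_neg_mul_sq (b := 1 / (2 * c)) (by positivity)
  refine this.congr (Filter.Eventually.of_forall fun z => ?_)
  simp only
  congr 1
  ring

lemma J_formula {s : ℝ → ℝ} (hs : Measurable s) (hs1 : ∀ x, s x = 1 ∨ s x = -1) {R : ℝ}
    (hR : 0 < R) {c : ℝ} (hc : 0 < c) :
    Integrable (fun d => Kc c d * AC s R d) ∧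
    ∫ u : ℝ, Real.exp (-(c / 2) * u ^ 2) * ‖FTm volume (gg s R) u‖ ^ 2
      = ∫ d, Kc c d * AC s R d := by
  have hg := gg_int hs hs1 R
  have hprod : Integrable (fun q : ℝ × ℝ => gg s R q.1 * Kc c q.2 * gg s R (q.1 + q.2))
      (volume.prod volume) := by
    refine (hg.mul_prod (Kc_int hc)).mul_bdd (c := R) ?_ (Filter.Eventually.of_forall fun q => ?_)
    · exact ((gg_meas hs R).comp (measurable_fst.add measurable_snd)).aestronglyMeasurable
    · exact gg_abs_le hs1 hR _
  have eAC : ∀ d, ∫ x, gg s R x * Kc c d * gg s R (x + d) = Kc c d * AC s R d := by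
    intro d
    unfold AC
    rw [← integral_const_mul]
    congr 1
    ext x
    ring
  refine ⟨?_, ?_⟩
  · have := hprod.integral_prod_right
    simpa only [eAC] using this
  · have h := FF hg hg hc
    have hfint : Integrable (fun z : ℝ × ℝ => gg s R z.1 * gg s R z.2 * Kc c (z.1 - z.2))
        (volume.prod volume) := by
      refine (hg.mul_prod hg).mul_bdd (c := √(2 * Real.pi / c)) ?_
        (Filter.Eventually.of_forall fun q => ?_)
      · exact ((Kc_cont c).measurable.comp (measurable_fst.sub measurable_snd)).aestronglyMeasurable
      · rw [Real.norm_eq_abs, abs_of_nonneg (Kc_nonneg _ _)]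
        exact Kc_le hc _
    have h2 : ∫ z : ℝ × ℝ, gg s R z.1 * gg s R z.2 * Kc c (z.1 - z.2) ∂(volume.prod volume)
        = ∫ d, Kc c d * AC s R d := by
      rw [integral_prod _ hfint]
      have : ∀ x, ∫ y, gg s R x * gg s R y * Kc c (x - y)
          = ∫ d, gg s R x * Kc c d * gg s R (x + d) := by
        intro x
        rw [← integral_add_left_eq_self (fun y => gg s R x * gg s R y * Kc c (x - y)) x]
        congr 1
        ext d
        have : Kc c (x - (x + d)) = Kc c d := by
          unfold Kc; congr 3; ring
        rw [this]
        ring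
      simp_rw [this]
      rw [integral_integral_swap hprod]
      simp_rw [eAC]
    rw [← h2]
    simp_rw [FTm_sq, ← Complex.ofReal_mul] at h
    rw [integral_complex_ofReal] at h
    exact_mod_cast h

lemma Kc_integral {c : ℝ} (hc : 0 < c) : ∫ d, Kc c d = 2 * Real.pi := by
  unfold Kc
  rw [integral_const_mul]
  have e : ∀ z : ℝ, -z ^ 2 / (2 * c) = -(1 / (2 * c)) * z ^ 2 := fun z => by ring
  simp_rw [e]
  rw [integral_gaussian, ← Real.sqrt_mul (by positivity)]
  rw [show 2 * Real.pi / c * (Real.pi / (1 / (2 * c))) = (2 * Real.pi) ^ 2 by field_simp]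
  exact Real.sqrt_sq (by positivity)

lemma Kc_sq_int {c : ℝ} (hc : 0 < c) : Integrable (fun d => d ^ 2 * Kc c d) := by
  unfold Kc
  have := (gm_int 2 (c := 1 / (2 * c)) (by positivity)).const_mul (√(2 * Real.pi / c))
  refine this.congr (Filter.Eventually.of_forall fun z => ?_)
  simp only
  rw [show -z ^ 2 / (2 * c) = -(1 / (2 * c)) * z ^ 2 by ring]
  ring

lemma Kc_sq_integral {c : ℝ} (hc : 0 < c) : ∫ d, d ^ 2 * Kc c d = 2 * Real.pi * c := by
  rw [← Kc_integral hc]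
  unfold Kc
  have e : ∀ z : ℝ, -z ^ 2 / (2 * c) = -(1 / (2 * c)) * z ^ 2 := fun z => by ring
  simp_rw [e]
  have e2 : ∀ z : ℝ, z ^ 2 * (√(2 * Real.pi / c) * Real.exp (-(1 / (2 * c)) * z ^ 2))
    = √(2 * Real.pi / c) * (z ^ 2 * Real.exp (-(1 / (2 * c)) * z ^ 2)) := fun z => by ring
  simp_rw [e2]
  rw [integral_const_mul, integral_const_mul, gm_two (by positivity), integral_gaussian]
  field_simp

lemma J_cert {s : ℝ → ℝ} (hs : Measurable s) (hs1 : ∀ x, s x = 1 ∨ s x = -1) {R : ℝ}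
    (hR : 0 < R) {c : ℝ} (hc : 0 < c) :
    2 * (∫ u : ℝ, Real.exp (-(c / 2) * u ^ 2) * ‖FTm volume (gg s R) u‖ ^ 2)
      - (∫ u : ℝ, Real.exp (-((4 * c) / 2) * u ^ 2) * ‖FTm volume (gg s R) u‖ ^ 2)
      ≤ 2 * Real.pi * (2 * R ^ 3 / 3 + 2 * c * R) := by
  obtain ⟨i1, e1⟩ := J_formula hs hs1 hR hc
  obtain ⟨i4, e4⟩ := J_formula hs hs1 hR (c := 4 * c) (by positivity)
  have hK : ∀ d, Kc (4 * c) (2 * d) = 1 / 2 * Kc c d := by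
    intro d
    unfold Kc
    rw [show 2 * Real.pi / (4 * c) = (1 / 2) ^ 2 * (2 * Real.pi / c) by field_simp; norm_num,
      Real.sqrt_mul (by positivity), Real.sqrt_sq (by norm_num), mul_assoc]
    congr 3
    field_simp
    ring
  have i4' : Integrable (fun d => Kc c d * AC s R (2 * d)) := by
    have := (i4.comp_mul_left' (R := 2) two_ne_zero).const_mul 2
    refine this.congr (Filter.Eventually.of_forall fun d => ?_)
    simp only [hK]
    ring
  have e4' : ∫ d, Kc (4 * c) d * AC s R d = ∫ d, Kc c d * AC s R (2 * d) := by
    have h := Measure.integral_comp_mul_left (fun d => Kc (4 * c) d * AC s R d) 2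
    simp only [hK, smul_eq_mul] at h
    have h3 : ∫ d, 1 / 2 * Kc c d * AC s R (2 * d) = 1 / 2 * ∫ d, Kc c d * AC s R (2 * d) := by
      rw [← integral_const_mul]
      congr 1; ext d; ring
    rw [h3] at h
    norm_num at h
    exact h.symm
  rw [e1, e4, e4', ← integral_const_mul, ← integral_sub (i1.const_mul 2) i4']
  calc _ ≤ ∫ d, ((2 * R ^ 3 / 3) * Kc c d + 2 * R * (d ^ 2 * Kc c d)) := by
        apply integral_mono ((i1.const_mul 2).sub i4')
          (((Kc_int hc).const_mul _).add ((Kc_sq_int hc).const_mul _))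
        intro d
        have := mul_le_mul_of_nonneg_left (AC_ineq hs hs1 hR d) (Kc_nonneg c d)
        simp only [Pi.sub_apply, Pi.add_apply]
        nlinarith [this]
    _ = _ := by
        rw [integral_add ((Kc_int hc).const_mul _) ((Kc_sq_int hc).const_mul _),
          integral_const_mul, integral_const_mul, Kc_integral hc, Kc_sq_integral hc]
        ring

lemma Kc_one (z : ℝ) : Kc 1 z = 2 * Real.pi * gaussianPDFReal 0 1 z := by
  unfold Kc gaussianPDFReal
  simp only [NNReal.coe_one, mul_one, div_one, sub_zero]
  rw [← mul_assoc]
  congr 1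
  have h : 0 < √(2 * Real.pi) := by positivity
  have h2 := Real.mul_self_sqrt (show (0:ℝ) ≤ 2 * Real.pi by positivity)
  field_simp
  rw [sq]; exact h2

lemma conv_prod_int {ν : Measure ℝ} [IsProbabilityMeasure ν] {h : ℝ → ℝ} (hi : Integrable h) :
    Integrable (fun z : ℝ × ℝ => (1:ℝ) * h z.2 * Kc 1 (z.1 - z.2)) (ν.prod volume) := by
  refine ((integrable_const (1:ℝ)).mul_prod hi).mul_bdd (c := √(2 * Real.pi / 1)) ?_
    (Filter.Eventually.of_forall fun q => ?_)
  · exact ((Kc_cont 1).measurable.comp (measurable_fst.sub measurable_snd)).aestronglyMeasurable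
  · rw [Real.norm_eq_abs, abs_of_nonneg (Kc_nonneg _ _)]
    exact Kc_le one_pos _

lemma conv_formula {ν : Measure ℝ} [IsProbabilityMeasure ν] {h : ℝ → ℝ} (hm : Measurable h)
    {M : ℝ} (hM : ∀ x, |h x| ≤ M) (hi : Integrable h) :
    ∫ x, h x ∂(ν ∗ gaussianReal 0 1)
      = 1 / (2 * Real.pi) * ∫ z : ℝ × ℝ, (1:ℝ) * h z.2 * Kc 1 (z.1 - z.2) ∂(ν.prod volume) := by
  have hb : Integrable h (ν ∗ gaussianReal 0 1) :=
    Integrable.of_bound hm.aestronglyMeasurable M (Filter.Eventually.of_forall hM)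
  rw [integral_conv hb, integral_prod _ (conv_prod_int hi), ← integral_const_mul]
  congr 1
  ext x
  rw [integral_gaussianReal_eq_integral_smul one_ne_zero,
    ← integral_add_left_eq_self (fun y => (1:ℝ) * h y * Kc 1 (x - y)) x, ← integral_const_mul]
  congr 1
  ext y
  have : Kc 1 (x - (x + y)) = Kc 1 y := by
    unfold Kc; congr 3; ring
  rw [this, Kc_one, smul_eq_mul]
  field_simp

lemma conv_fourier {ν : Measure ℝ} [IsProbabilityMeasure ν] {h : ℝ → ℝ} (hm : Measurable h)
    {M : ℝ} (hM : ∀ x, |h x| ≤ M) (hi : Integrable h) :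
    ((∫ x, h x ∂(ν ∗ gaussianReal 0 1) : ℝ) : ℂ)
      = 1 / (2 * Real.pi) * ∫ u : ℝ, ((Real.exp (-(1 / 2) * u ^ 2) : ℝ) : ℂ)
          * (FTm ν (fun _ => 1) u * FTm volume h (-u)) := by
  rw [conv_formula hm hM hi, FF (integrable_const (1:ℝ)) hi one_pos]
  push_cast
  rfl

lemma conv_fourier_int {ν : Measure ℝ} [IsProbabilityMeasure ν] {h : ℝ → ℝ}
    (hi : Integrable h) :
    Integrable fun u : ℝ => ((Real.exp (-(1 / 2) * u ^ 2) : ℝ) : ℂ)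
          * (FTm ν (fun _ => 1) u * FTm volume h (-u)) := by
  have hE : Integrable (fun u : ℝ => Real.exp (-(1 / 2) * u ^ 2)) :=
      integrable_exp_neg_mul_sq (by norm_num)
  refine hE.ofReal.mul_bdd (c := 1 * ∫ y, |h y|) ?_ (Filter.Eventually.of_forall fun u => ?_)
  · exact ((FTm_cont (integrable_const (1:ℝ))).mul
      ((FTm_cont hi).comp continuous_neg)).aestronglyMeasurable
  · rw [norm_mul]
    refine mul_le_mul ((FTm_norm_le u).trans ?_) (FTm_norm_le _) (norm_nonneg _) zero_le_one
    simp

lemma conv_diff_le {ν1 ν2 : Measure ℝ} [IsProbabilityMeasure ν1] [IsProbabilityMeasure ν2]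
    {h : ℝ → ℝ} (hm : Measurable h)
    {M : ℝ} (hM : ∀ x, |h x| ≤ M) (hi : Integrable h) :
    ∫ x, h x ∂(ν1 ∗ gaussianReal 0 1) - ∫ x, h x ∂(ν2 ∗ gaussianReal 0 1)
      ≤ 1 / (2 * Real.pi) * ∫ u : ℝ, Real.exp (-(1 / 2) * u ^ 2)
          * (‖charFn ν1 u - charFn ν2 u‖ * ‖FTm volume h u‖) := by
  have hc : ∀ (ν : Measure ℝ) u, FTm ν (fun _ => 1) u = charFn ν u := by
    intro ν u; simp [FTm, charFn]
  have e : ((∫ x, h x ∂(ν1 ∗ gaussianReal 0 1) - ∫ x, h x ∂(ν2 ∗ gaussianReal 0 1) : ℝ) : ℂ)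
      = 1 / (2 * Real.pi) * ∫ u : ℝ, ((Real.exp (-(1 / 2) * u ^ 2) : ℝ) : ℂ)
          * ((charFn ν1 u - charFn ν2 u) * FTm volume h (-u)) := by
    rw [Complex.ofReal_sub, conv_fourier hm hM hi, conv_fourier hm hM hi, ← mul_sub,
      ← integral_sub (conv_fourier_int hi) (conv_fourier_int hi)]
    congr 2
    ext u
    rw [hc, hc]
    ring
  refine (le_abs_self _).trans ?_
  rw [← Real.norm_eq_abs, ← Complex.norm_real, e, norm_mul]
  have : ‖(1 / (2 * Real.pi) : ℂ)‖ = 1 / (2 * Real.pi) := by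
    rw [show (1 / (2 * Real.pi) : ℂ) = ((1 / (2 * Real.pi) : ℝ) : ℂ) by push_cast; rfl,
      Complex.norm_real, Real.norm_eq_abs, abs_of_pos (by positivity)]
  rw [this]
  refine mul_le_mul_of_nonneg_left ?_ (by positivity)
  refine (norm_integral_le_integral_norm _).trans (le_of_eq ?_)
  congr 1
  ext u
  rw [norm_mul, norm_mul, Complex.norm_real, Real.norm_eq_abs, abs_of_pos (Real.exp_pos _),
    FTm_neg, RCLike.norm_conj]

lemma conv_dens_le {ν : Measure ℝ} [IsProbabilityMeasure ν]
    {h : ℝ → ℝ} (hm : Measurable h) (h0 : ∀ x, 0 ≤ h x)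
    {M : ℝ} (hM : ∀ x, |h x| ≤ M) (hi : Integrable h) :
    ∫ x, h x ∂(ν ∗ gaussianReal 0 1) ≤ 1 / √(2 * Real.pi) * ∫ x, h x := by
  rw [conv_formula hm hM hi]
  have hle : ∫ z : ℝ × ℝ, (1:ℝ) * h z.2 * Kc 1 (z.1 - z.2) ∂(ν.prod volume)
      ≤ ∫ z : ℝ × ℝ, √(2 * Real.pi) * ((1:ℝ) * h z.2) ∂(ν.prod volume) := by
    refine integral_mono (conv_prod_int hi)
      (((integrable_const (1:ℝ)).mul_prod hi).const_mul _) fun z => ?_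
    have := Kc_le one_pos (z.1 - z.2)
    rw [div_one] at this
    simp only
    nlinarith [h0 z.2]
  rw [integral_const_mul, integral_prod _ ((integrable_const (1:ℝ)).mul_prod hi)] at hle
  simp at hle
  have hp : 0 < √(2 * Real.pi) := by positivity
  have h2 := Real.mul_self_sqrt (show (0:ℝ) ≤ 2 * Real.pi by positivity)
  calc _ ≤ 1 / (2 * Real.pi) * (√(2 * Real.pi) * ∫ x, h x) :=
        mul_le_mul_of_nonneg_left (by simpa using hle) (by positivity)
    _ = _ := by
        rw [show 1 / (2 * Real.pi) = 1 / (√(2 * Real.pi) * √(2 * Real.pi)) by rw [h2]]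
        generalize √(2 * Real.pi) = q at *
        field_simp

lemma slack_one {ν : Measure ℝ} [IsProbabilityMeasure ν] {s : ℝ → ℝ} (hs : Measurable s)
    (hs1 : ∀ x, s x = 1 ∨ s x = -1) {m R r : ℝ} (hR : 0 < R) (hr : 0 ≤ r) (hrR : r ≤ R)
    (hi : Integrable (fun x => |x|) (ν ∗ gaussianReal 0 1))
    (hm : ∫ x, |x| ∂(ν ∗ gaussianReal 0 1) ≤ m) :
    R * ∫ x, s x ∂(ν ∗ gaussianReal 0 1) ≤ ∫ x, gg s R x ∂(ν ∗ gaussianReal 0 1) + m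
      - (r * (1 - ∫ x, s x ∂(ν ∗ gaussianReal 0 1))
          - 1 / √(2 * Real.pi) * ∫ x, (1 - s x) * Lam r x) := by
  have hsb : ∀ x, |s x| ≤ 1 := fun x => (sgn_abs (hs1 x)).le
  have h1s : ∀ x, 0 ≤ 1 - s x := fun x => by rcases hs1 x with h | h <;> rw [h] <;> norm_num
  have h1s2 : ∀ x, |1 - s x| ≤ 2 := fun x => by rcases hs1 x with h | h <;> rw [h] <;> norm_num
  have hmm : Measurable fun x => (1 - s x) * Lam r x :=
    (measurable_const.sub hs).mul (Lam_cont r).measurable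
  have hbb : ∀ x, |(1 - s x) * Lam r x| ≤ 2 * r := fun x => by
    rw [abs_mul]
    refine mul_le_mul (h1s2 x) ?_ (abs_nonneg _) (by norm_num)
    rw [abs_of_nonneg (Lam_nonneg _ _)]; exact Lam_le hr x
  have hv : Integrable fun x => (1 - s x) * Lam r x :=
    (Lam_int r).bdd_mul (c := 2) (measurable_const.sub hs).aestronglyMeasurable
      (Filter.Eventually.of_forall h1s2)
  have hd := conv_dens_le (ν := ν) hmm (fun x => mul_nonneg (h1s x) (Lam_nonneg _ _)) hbb hv
  set μ := ν ∗ gaussianReal 0 1 with hμ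
  have is : Integrable s μ :=
    Integrable.of_bound hs.aestronglyMeasurable 1 (Filter.Eventually.of_forall hsb)
  have ig : Integrable (gg s R) μ :=
    Integrable.of_bound (gg_meas hs R).aestronglyMeasurable R
      (Filter.Eventually.of_forall (gg_abs_le hs1 hR))
  have iL : Integrable (fun x => (1 - s x) * Lam r x) μ :=
    Integrable.of_bound hmm.aestronglyMeasurable _ (Filter.Eventually.of_forall hbb)
  have hpt : ∀ x, R * s x ≤ gg s R x + |x| - (r * (1 - s x) - (1 - s x) * Lam r x) := by
    intro x
    have h1 : R - Lam R x ≤ |x| := by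
      rcases Lam_cases R x with h | h <;> rw [h.1] <;> linarith
    have h2 : r - Lam r x ≤ R - Lam R x := by
      rcases Lam_cases R x with h | h <;> rcases Lam_cases r x with h' | h' <;>
        rw [h.1, h'.1] <;> linarith
    unfold gg
    nlinarith [h1s x]
  have hle := integral_mono (is.const_mul R)
    ((ig.add hi).sub ((((integrable_const (1:ℝ)).sub is).const_mul r).sub iL)) hpt
  rw [integral_const_mul, integral_sub' (ig.add hi)
    ((((integrable_const (1:ℝ)).sub is).const_mul r).sub iL), integral_add' ig hi,
    integral_sub' (((integrable_const (1:ℝ)).sub is).const_mul r) iL, integral_const_mul,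
    integral_sub' (integrable_const (1:ℝ)) is] at hle
  simp only [integral_const, probReal_univ, smul_eq_mul, mul_one] at hle
  linarith

lemma slack_two {ν1 ν2 : Measure ℝ} [IsProbabilityMeasure ν1] [IsProbabilityMeasure ν2]
    {s : ℝ → ℝ} (hs : Measurable s)
    (hs1 : ∀ x, s x = 1 ∨ s x = -1) {m R r t : ℝ} (hR : 0 < R) (hr : 0 ≤ r) (hrR : r ≤ R)
    (hi1 : Integrable (fun x => |x|) (ν1 ∗ gaussianReal 0 1))
    (hm1 : ∫ x, |x| ∂(ν1 ∗ gaussianReal 0 1) ≤ m)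
    (hi2 : Integrable (fun x => |x|) (ν2 ∗ gaussianReal 0 1))
    (hm2 : ∫ x, |x| ∂(ν2 ∗ gaussianReal 0 1) ≤ m)
    (ht : ∫ x, s x ∂(ν1 ∗ gaussianReal 0 1) - ∫ x, s x ∂(ν2 ∗ gaussianReal 0 1) = 2 * t) :
    2 * R * t ≤ (∫ x, gg s R x ∂(ν1 ∗ gaussianReal 0 1) - ∫ x, gg s R x ∂(ν2 ∗ gaussianReal 0 1))
      + 2 * m - 2 * (r * (1 - t) - 1 / √(2 * Real.pi) * r ^ 2) := by
  have a1 := slack_one hs hs1 hR hr hrR hi1 hm1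
  have a2 := slack_one (s := fun x => - s x) hs.neg
    (fun x => by rcases hs1 x with h | h <;> simp [h]) hR hr hrR hi2 hm2
  have hgn : ∀ x, gg (fun x => - s x) R x = - gg s R x := fun x => by unfold gg; ring
  simp only [hgn, integral_neg] at a2
  have hitg : ∀ s' : ℝ → ℝ, Measurable s' → (∀ x, s' x = 1 ∨ s' x = -1) →
      Integrable fun x => (1 - s' x) * Lam r x := by
    intro s' h h'
    refine (Lam_int r).bdd_mul (c := 2) (measurable_const.sub h).aestronglyMeasurable
      (Filter.Eventually.of_forall fun x => ?_)
    rcases h' x with h | h <;> rw [h] <;> norm_num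
  have hsum : (∫ x, (1 - s x) * Lam r x) + (∫ x, (1 - - s x) * Lam r x) = 2 * r ^ 2 := by
    rw [← integral_add (hitg s hs hs1) (hitg (fun x => - s x) hs.neg
      (fun x => by rcases hs1 x with h | h <;> simp [h])), ← Lam_integral hr, ← integral_const_mul]
    congr 1
    ext x
    ring
  have : 1 / √(2 * Real.pi) * (∫ x, (1 - s x) * Lam r x)
      + 1 / √(2 * Real.pi) * (∫ x, (1 - - s x) * Lam r x) = 2 * (1 / √(2 * Real.pi) * r ^ 2) := by
    rw [← mul_add, hsum]; ring
  nlinarith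

lemma mean_lower {ν : Measure ℝ} [IsProbabilityMeasure ν] {m : ℝ}
    (hi : Integrable (fun x => |x|) (ν ∗ gaussianReal 0 1))
    (hm : ∫ x, |x| ∂(ν ∗ gaussianReal 0 1) ≤ m) : √(2 * Real.pi) / 4 ≤ m := by
  have hq : 0 < √(2 * Real.pi) := by positivity
  have h := slack_two (s := fun _ => 1) (t := 0) (ν1 := ν) (ν2 := ν) (r := √(2 * Real.pi) / 2)
    (R := √(2 * Real.pi) / 2)
    measurable_const (fun _ => Or.inl rfl) (by positivity) (by positivity) le_rfl hi hm hi hm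
    (by simp)
  have e : √(2 * Real.pi) / 2 * (1 - 0) - 1 / √(2 * Real.pi) * (√(2 * Real.pi) / 2) ^ 2
    = √(2 * Real.pi) / 4 := by
    generalize √(2 * Real.pi) = q at *
    field_simp; norm_num
  rw [e] at h
  linarith

/-- dual weight -/
noncomputable def WW (u : ℝ) : ℝ :=
  113 / 225 * Real.exp (-(8 / 9) * u ^ 2) + 149 / 675 * Real.exp (-(11 / 9) * u ^ 2)
    + 521 / 2025 * Real.exp (-(14 / 9) * u ^ 2) - 8 / 45 * Real.exp (-(17 / 9) * u ^ 2)
    + 16 / 81 * Real.exp (-(20 / 9) * u ^ 2)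

lemma exp_pow_y (u : ℝ) (k : ℕ) : Real.exp (-(k / 9) * u ^ 2) = Real.exp (-u ^ 2 / 9) ^ k := by
  rw [← Real.exp_nat_mul]; congr 1; ring

lemma WW_y (u : ℝ) : WW u = Real.exp (-u ^ 2 / 9) ^ 8 * (113 / 225
    + 149 / 675 * Real.exp (-u ^ 2 / 9) ^ 3 + 521 / 2025 * Real.exp (-u ^ 2 / 9) ^ 6
    - 8 / 45 * Real.exp (-u ^ 2 / 9) ^ 9 + 16 / 81 * Real.exp (-u ^ 2 / 9) ^ 12) := by
  unfold WW
  have h8 := exp_pow_y u 8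
  have h11 := exp_pow_y u 11
  have h14 := exp_pow_y u 14
  have h17 := exp_pow_y u 17
  have h20 := exp_pow_y u 20
  push_cast at *
  rw [h8, h11, h14, h17, h20]
  ring

lemma WW_v (u : ℝ) : Real.exp (-u ^ 2) ≤ WW u *
    (2 * Real.exp (-((2 / 9 : ℝ) / 2) * u ^ 2) - Real.exp (-((4 * (2 / 9 : ℝ)) / 2) * u ^ 2)) := by
  have h1 := exp_pow_y u 1
  have h4 := exp_pow_y u 4
  have h9 := exp_pow_y u 9
  push_cast at *
  rw [show -u ^ 2 = -(9 / 9) * u ^ 2 by ring, show -((2 / 9 : ℝ) / 2) * u ^ 2 = -(1/9) * u ^ 2 by ring,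
    show -((4 * (2 / 9 : ℝ)) / 2) * u ^ 2 = -(4/9) * u ^ 2 by ring, h1, h4, h9, WW_y]
  have hy : 0 < Real.exp (-u ^ 2 / 9) := Real.exp_pos _
  have hy1 : Real.exp (-u ^ 2 / 9) ≤ 1 := by
    rw [Real.exp_le_one_iff]; nlinarith [sq_nonneg u]
  generalize Real.exp (-u ^ 2 / 9) = y at *
  have hz : y ^ 3 ≤ 1 := pow_le_one₀ hy.le hy1
  have key : y ^ 8 * (113 / 225 + 149 / 675 * y ^ 3 + 521 / 2025 * y ^ 6
    - 8 / 45 * y ^ 9 + 16 / 81 * y ^ 12) * (2 * y ^ 1 - y ^ 4) - y ^ 9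
    = y ^ 9 * (16 / 81 * ((1 - y ^ 3) * ((y ^ 3 - 1 / 5) ^ 2 * (y ^ 3 - 3 / 4) ^ 2))) := by ring
  have : 0 ≤ y ^ 9 * (16 / 81 * ((1 - y ^ 3) * ((y ^ 3 - 1 / 5) ^ 2 * (y ^ 3 - 3 / 4) ^ 2))) := by
    have : 0 ≤ 1 - y ^ 3 := by linarith
    positivity
  linarith

lemma v_pos (u : ℝ) : 0 < 
    (2 * Real.exp (-((2 / 9 : ℝ) / 2) * u ^ 2) - Real.exp (-((4 * (2 / 9 : ℝ)) / 2) * u ^ 2)) := by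
  have : Real.exp (-((4 * (2 / 9 : ℝ)) / 2) * u ^ 2) ≤ Real.exp (-((2 / 9 : ℝ) / 2) * u ^ 2) := by
    apply Real.exp_le_exp.2; nlinarith [sq_nonneg u]
  linarith [Real.exp_pos (-((2 / 9 : ℝ) / 2) * u ^ 2)]

lemma v_le (u : ℝ) : 
    (2 * Real.exp (-((2 / 9 : ℝ) / 2) * u ^ 2) - Real.exp (-((4 * (2 / 9 : ℝ)) / 2) * u ^ 2))
     ≤ 5 / 4 := by
  have h1 := exp_pow_y u 1
  have h4 := exp_pow_y u 4
  push_cast at *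
  rw [show -((2 / 9 : ℝ) / 2) * u ^ 2 = -(1/9) * u ^ 2 by ring,
    show -((4 * (2 / 9 : ℝ)) / 2) * u ^ 2 = -(4/9) * u ^ 2 by ring, h1, h4]
  generalize Real.exp (-u ^ 2 / 9) = y at *
  nlinarith [sq_nonneg (y ^ 2 - 5 / 8), sq_nonneg (y - 4 / 5)]

lemma WW_lower (u : ℝ) : 4 / 5 * Real.exp (-u ^ 2) ≤ WW u := by
  have h1 := WW_v u
  have h2 := v_pos u
  have h3 := v_le u
  have h4 := Real.exp_pos (-u ^ 2)
  generalize (2 * Real.exp (-((2 / 9 : ℝ) / 2) * u ^ 2)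
    - Real.exp (-((4 * (2 / 9 : ℝ)) / 2) * u ^ 2)) = v at *
  have hW : 0 < WW u := by
    by_contra h
    push Not at h
    nlinarith
  nlinarith

lemma amgm_pt {u D F T l q : ℝ} {n : ℕ} (hD : 0 ≤ D) (hD2 : D ≤ 2) (hDT : D ≤ T * |u|)
    (hl : 0 < l) (hq : 0 ≤ q) (hq1 : q * u ^ (2 * n) * Real.exp (-u ^ 2) ≤ 1) :
    Real.exp (-(1 / 2) * u ^ 2) * (D * F) ≤ 1 / 2 * (l *
      (2 * (Real.exp (-((2 / 9 : ℝ) / 2) * u ^ 2) * F ^ 2)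
        - Real.exp (-((4 * (2 / 9 : ℝ)) / 2) * u ^ 2) * F ^ 2)
      + 1 / l * (T ^ 2 * (u ^ 2 * WW u) - 4 / 5 * q *
        (T ^ 2 * (u ^ (2 * n + 2) * Real.exp (-2 * u ^ 2))
          - 4 * (u ^ (2 * n) * Real.exp (-2 * u ^ 2))))) := by
  have h1 := WW_v u
  have h2 := v_pos u
  have hWl := WW_lower u
  have hE := Real.exp_pos (-u ^ 2)
  have hT : D ^ 2 ≤ T ^ 2 * u ^ 2 := by
    rw [← sq_abs u, ← mul_pow]; exact pow_le_pow_left₀ hD hDT 2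
  have hD4 : D ^ 2 ≤ 4 := by nlinarith
  have hh : Real.exp (-(1 / 2) * u ^ 2) ^ 2 = Real.exp (-u ^ 2) := by
    rw [← Real.exp_nat_mul]; congr 1; push_cast; ring
  have he2 : Real.exp (-2 * u ^ 2) = Real.exp (-u ^ 2) * Real.exp (-u ^ 2) := by
    rw [← Real.exp_add]; congr 1; ring
  rw [he2]
  have hp0 : 0 ≤ q * u ^ (2 * n) * Real.exp (-u ^ 2) := by
    have : 0 ≤ u ^ (2 * n) := by rw [pow_mul]; positivity
    positivity
  have e1 : T ^ 2 * (u ^ 2 * WW u) - 4 / 5 * q *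
        (T ^ 2 * (u ^ (2 * n + 2) * (Real.exp (-u ^ 2) * Real.exp (-u ^ 2)))
          - 4 * (u ^ (2 * n) * (Real.exp (-u ^ 2) * Real.exp (-u ^ 2))))
      = T ^ 2 * u ^ 2 * WW u - 4 / 5 * Real.exp (-u ^ 2) *
        (q * u ^ (2 * n) * Real.exp (-u ^ 2)) * (T ^ 2 * u ^ 2 - 4) := by
    rw [pow_add]; ring
  rw [e1]
  have e2 : 2 * (Real.exp (-((2 / 9 : ℝ) / 2) * u ^ 2) * F ^ 2)
        - Real.exp (-((4 * (2 / 9 : ℝ)) / 2) * u ^ 2) * F ^ 2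
     = (2 * Real.exp (-((2 / 9 : ℝ) / 2) * u ^ 2)
        - Real.exp (-((4 * (2 / 9 : ℝ)) / 2) * u ^ 2)) * F ^ 2 := by ring
  rw [e2]
  generalize (2 * Real.exp (-((2 / 9 : ℝ) / 2) * u ^ 2)
    - Real.exp (-((4 * (2 / 9 : ℝ)) / 2) * u ^ 2)) = v at *
  generalize q * u ^ (2 * n) * Real.exp (-u ^ 2) = p at *
  generalize T ^ 2 * u ^ 2 = S at *
  generalize WW u = W at *
  rw [← hh] at h1 hWl hE ⊢
  generalize Real.exp (-(1 / 2) * u ^ 2) = h at *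
  have hW : 0 < W := by linarith
  have hB : D ^ 2 * W ≤ S * W - 4 / 5 * h ^ 2 * p * (S - 4) := by
    rcases le_total S 4 with hS | hS
    · have : 0 ≤ 4 / 5 * h ^ 2 * p * (4 - S) := by
        have : 0 ≤ 4 - S := by linarith
        positivity
      nlinarith
    · have a1 : 4 / 5 * h ^ 2 * p ≤ W := by nlinarith
      have a2 : 4 / 5 * h ^ 2 * p * (S - 4) ≤ W * (S - 4) :=
        mul_le_mul_of_nonneg_right a1 (by linarith)
      nlinarith
  have hstep : h * (D * F) ≤ 1 / 2 * (l * (v * F ^ 2) + 1 / l * (D ^ 2 * W)) := by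
    refine le_of_sq_le_sq ?_ (by positivity)
    have a : (h * (D * F)) ^ 2 ≤ (l * (v * F ^ 2)) * (1 / l * (D ^ 2 * W)) := by
      have : (l * (v * F ^ 2)) * (1 / l * (D ^ 2 * W)) = (W * v) * (D ^ 2 * F ^ 2) := by
        field_simp
      rw [this]
      have : (h * (D * F)) ^ 2 = h ^ 2 * (D ^ 2 * F ^ 2) := by ring
      rw [this]
      exact mul_le_mul_of_nonneg_right h1 (by positivity)
    nlinarith [sq_nonneg (l * (v * F ^ 2) - 1 / l * (D ^ 2 * W))]
  refine hstep.trans ?_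
  have : 1 / l * (D ^ 2 * W) ≤ 1 / l * (S * W - 4 / 5 * h ^ 2 * p * (S - 4)) :=
    mul_le_mul_of_nonneg_left hB (by positivity)
  linarith

lemma gm_two' {k : ℝ} (hk : 0 < k) :
    ∫ u : ℝ, u ^ 2 * Real.exp (-(k / 9) * u ^ 2) = √Real.pi / 2 * (27 * √k / k ^ 2) := by
  rw [gm_two (by positivity)]
  have : √(Real.pi / (k / 9)) = 3 * √Real.pi / √k := by
    rw [show Real.pi / (k / 9) = 3 ^ 2 * Real.pi / k by field_simp; norm_num,
      Real.sqrt_div (by positivity), Real.sqrt_mul (by positivity), Real.sqrt_sq (by norm_num)]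
  rw [this]
  have hs := Real.sq_sqrt hk.le
  have hp : 0 < √k := Real.sqrt_pos.2 hk
  rw [← hs, Real.sqrt_sq hp.le]
  field_simp
  norm_num

lemma WW_int : Integrable (fun u => u ^ 2 * WW u) := by
  have h : ∀ k : ℝ, 0 < k → Integrable (fun u : ℝ => u ^ 2 * Real.exp (-k * u ^ 2)) :=
    fun k hk => gm_int 2 hk
  have := (((((h (8/9) (by norm_num)).const_mul (113/225)).add
    ((h (11/9) (by norm_num)).const_mul (149/675))).add
    ((h (14/9) (by norm_num)).const_mul (521/2025))).sub
    ((h (17/9) (by norm_num)).const_mul (8/45))).add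
    ((h (20/9) (by norm_num)).const_mul (16/81))
  refine this.congr (Filter.Eventually.of_forall fun u => ?_)
  simp only [Pi.add_apply, Pi.sub_apply, WW]
  ring

lemma WW_integral : ∫ u, u ^ 2 * WW u ≤ √Real.pi / 2 * (8 / 9 - 24 / 10000) := by
  have h : ∀ k : ℝ, 0 < k → Integrable (fun u : ℝ => u ^ 2 * Real.exp (-k * u ^ 2)) :=
    fun k hk => gm_int 2 hk
  have i1 := (h (8/9) (by norm_num)).const_mul (113/225)
  have i2 := (h (11/9) (by norm_num)).const_mul (149/675)
  have i3 := (h (14/9) (by norm_num)).const_mul (521/2025)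
  have i4 := (h (17/9) (by norm_num)).const_mul (8/45)
  have i5 := (h (20/9) (by norm_num)).const_mul (16/81)
  have e : (fun u => u ^ 2 * WW u) = ((((fun u : ℝ => 113/225 * (u ^ 2 * Real.exp (-(8/9) * u ^ 2)))
      + (fun u : ℝ => 149/675 * (u ^ 2 * Real.exp (-(11/9) * u ^ 2))))
      + (fun u : ℝ => 521/2025 * (u ^ 2 * Real.exp (-(14/9) * u ^ 2))))
      - (fun u : ℝ => 8/45 * (u ^ 2 * Real.exp (-(17/9) * u ^ 2))))
      + (fun u : ℝ => 16/81 * (u ^ 2 * Real.exp (-(20/9) * u ^ 2))) := by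
    ext u
    simp only [Pi.add_apply, Pi.sub_apply, WW]
    ring
  rw [e, integral_add' (((i1.add i2).add i3).sub i4) i5, integral_sub' ((i1.add i2).add i3) i4,
    integral_add' (i1.add i2) i3, integral_add' i1 i2]
  simp only [integral_const_mul]
  rw [gm_two' (k := 8) (by norm_num), gm_two' (k := 11) (by norm_num),
    gm_two' (k := 14) (by norm_num), gm_two' (k := 17) (by norm_num),
    gm_two' (k := 20) (by norm_num)]
  have s8 : √8 ≤ 2.82843 := by rw [Real.sqrt_le_left (by norm_num)]; norm_num
  have s11 : √11 ≤ 3.31663 := by rw [Real.sqrt_le_left (by norm_num)]; norm_num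
  have s14 : √14 ≤ 3.74166 := by rw [Real.sqrt_le_left (by norm_num)]; norm_num
  have s17 : 4.12310 ≤ √17 := by apply Real.le_sqrt_of_sq_le; norm_num
  have s20 : √20 ≤ 4.47214 := by rw [Real.sqrt_le_left (by norm_num)]; norm_num
  have hp : 0 ≤ √Real.pi / 2 := by positivity
  have : 113 / 225 * (27 * √8 / 8 ^ 2) + 149 / 675 * (27 * √11 / 11 ^ 2)
    + 521 / 2025 * (27 * √14 / 14 ^ 2) - 8 / 45 * (27 * √17 / 17 ^ 2)
    + 16 / 81 * (27 * √20 / 20 ^ 2) ≤ 8 / 9 - 24 / 10000 := by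
    norm_num at *
    linarith
  have := mul_le_mul_of_nonneg_left this hp
  linarith

lemma charFn_norm_le (ν : Measure ℝ) [IsProbabilityMeasure ν] (u : ℝ) : ‖charFn ν u‖ ≤ 1 := by
  unfold charFn
  refine (norm_integral_le_integral_norm _).trans ?_
  simp only [Complex.norm_exp_ofReal_mul_I]
  simp

lemma G_bound {ν1 ν2 : Measure ℝ} [IsProbabilityMeasure ν1] [IsProbabilityMeasure ν2]
    {s : ℝ → ℝ} (hs : Measurable s) (hs1 : ∀ x, s x = 1 ∨ s x = -1) {R T l q : ℝ} {n : ℕ}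
    (hR : 0 < R) (hl : 0 < l) (hq : 0 ≤ q)
    (hq1 : ∀ u : ℝ, q * u ^ (2 * n) * Real.exp (-u ^ 2) ≤ 1)
    (hT : ∀ u, ‖charFn ν1 u - charFn ν2 u‖ ≤ T * |u|) :
    ∫ x, gg s R x ∂(ν1 ∗ gaussianReal 0 1) - ∫ x, gg s R x ∂(ν2 ∗ gaussianReal 0 1)
      ≤ 1 / (2 * Real.pi) * (1 / 2 * (l * (2 * Real.pi * (2 * R ^ 3 / 3 + 2 * (2 / 9) * R))
        + 1 / l * (T ^ 2 * (√Real.pi / 2 * (8 / 9 - 24 / 10000)) - 4 / 5 * q *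
          (T ^ 2 * (∫ u : ℝ, u ^ (2 * n + 2) * Real.exp (-2 * u ^ 2))
            - 4 * (∫ u : ℝ, u ^ (2 * n) * Real.exp (-2 * u ^ 2)))))) := by
  have hg := gg_int hs hs1 R
  refine (conv_diff_le (gg_meas hs R) (gg_abs_le hs1 hR) hg).trans ?_
  refine mul_le_mul_of_nonneg_left ?_ (by positivity)
  have j1 := gexp_int hg (c := 2 / 9) (by norm_num)
  have j2 := gexp_int hg (c := 4 * (2 / 9)) (by norm_num)
  have k1 := gm_int (2 * n + 2) (c := 2) (by norm_num)
  have k2 := gm_int (2 * n) (c := 2) (by norm_num)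
  have J1 := ((j1.const_mul 2).sub j2).const_mul l
  have J2 := ((WW_int.const_mul (T ^ 2)).sub (((k1.const_mul (T ^ 2)).sub
    (k2.const_mul 4)).const_mul (4 / 5 * q))).const_mul (1 / l)
  have hle := integral_mono_of_nonneg (μ := volume)
    (f := fun u : ℝ => Real.exp (-(1 / 2) * u ^ 2)
          * (‖charFn ν1 u - charFn ν2 u‖ * ‖FTm volume (gg s R) u‖))
    (Filter.Eventually.of_forall fun u => by positivity) ((J1.add J2).const_mul (1 / 2))
    (Filter.Eventually.of_forall fun u =>
      amgm_pt (n := n) (q := q) (norm_nonneg _) (by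
        have := norm_sub_le (charFn ν1 u) (charFn ν2 u)
        linarith [charFn_norm_le ν1 u, charFn_norm_le ν2 u]) (hT u) hl hq (hq1 u))
  refine hle.trans ?_
  rw [integral_const_mul, integral_add' J1 J2, integral_const_mul, integral_const_mul,
    integral_sub' (j1.const_mul 2) j2, integral_const_mul,
    integral_sub' (WW_int.const_mul (T ^ 2)) (((k1.const_mul (T ^ 2)).sub
    (k2.const_mul 4)).const_mul (4 / 5 * q)), integral_const_mul, integral_const_mul,
    integral_sub' (k1.const_mul (T ^ 2)) (k2.const_mul 4), integral_const_mul, integral_const_mul]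
  refine mul_le_mul_of_nonneg_left ?_ (by norm_num)
  refine add_le_add (mul_le_mul_of_nonneg_left (J_cert hs hs1 hR (by norm_num)) hl.le) ?_
  refine mul_le_mul_of_nonneg_left ?_ (by positivity)
  refine sub_le_sub_right (mul_le_mul_of_nonneg_left WW_integral (sq_nonneg _)) _

lemma core_alg {p R X T q M N k m G κ : ℝ} (hp : 0 < p) (hR : 0 < R) (hX : 0 < X)
    (hT : T ^ 2 = 12 * p * X ^ 2 / R) (hN : N = k / 4 * M) (hm : m = R * X / 3)
    (h1 : G ≤ 1 / (2 * p ^ 2) * (1 / 2 * ((2 * X / R ^ 2) *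
        (2 * p ^ 2 * (2 * R ^ 3 / 3 + 2 * (2 / 9) * R))
        + 1 / (2 * X / R ^ 2) * (T ^ 2 * (p / 2 * (8 / 9 - 24 / 10000)) - 4 / 5 * q *
          (T ^ 2 * N - 4 * M)))))
    (h2 : 2 * R * X ≤ G + 2 * m - 2 * (κ * (1 - X) ^ 2)) :
    κ * (1 - X) ^ 2 * R / X + 3 / 8 * R ^ 2 * (24 / 10000 + 8 / (5 * p) * q * M *
      (k / 4 - R / (3 * p * X ^ 2))) ≤ 2 / 9 := by
  have e : 1 / (2 * p ^ 2) * (1 / 2 * ((2 * X / R ^ 2) *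
        (2 * p ^ 2 * (2 * R ^ 3 / 3 + 2 * (2 / 9) * R))
        + 1 / (2 * X / R ^ 2) * (T ^ 2 * (p / 2 * (8 / 9 - 24 / 10000)) - 4 / 5 * q *
          (T ^ 2 * N - 4 * M))))
     = 2 * X * R / 3 + 4 * X / (9 * R) + 3 / 4 * R * X * (8 / 9 - 24 / 10000 - 8 / (5 * p) * q * M *
      (k / 4 - R / (3 * p * X ^ 2))) := by
    rw [hT, hN]
    field_simp
    ring
  rw [e] at h1
  generalize 8 / (5 * p) * q * M * (k / 4 - R / (3 * p * X ^ 2)) = g at *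
  have h3 : 2 * (κ * (1 - X) ^ 2) + 3 / 4 * R * X * (24 / 10000 + g) ≤ 4 * X / (9 * R) := by
    rw [hm] at h2
    linarith
  have h4 := mul_le_mul_of_nonneg_left h3 (show 0 ≤ R / (2 * X) by positivity)
  have e1 : R / (2 * X) * (4 * X / (9 * R)) = 2 / 9 := by field_simp; norm_num
  have e2 : R / (2 * X) * (2 * (κ * (1 - X) ^ 2) + 3 / 4 * R * X * (24 / 10000 + g))
    = κ * (1 - X) ^ 2 * R / X + 3 / 8 * R ^ 2 * (24 / 10000 + g) := by field_simp; ring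
  rw [e1, e2] at h4
  exact h4

lemma core_ineq {ν1 ν2 : Measure ℝ} [IsProbabilityMeasure ν1] [IsProbabilityMeasure ν2]
    {s : ℝ → ℝ} (hs : Measurable s) (hs1 : ∀ x, s x = 1 ∨ s x = -1) {R T q X t m : ℝ} {n : ℕ}
    (hR : √(2 * Real.pi) / 2 ≤ R) (hq : 0 ≤ q)
    (hq1 : ∀ u : ℝ, q * u ^ (2 * n) * Real.exp (-u ^ 2) ≤ 1)
    (hT : ∀ u, ‖charFn ν1 u - charFn ν2 u‖ ≤ T * |u|)
    (hi1 : Integrable (fun x => |x|) (ν1 ∗ gaussianReal 0 1))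
    (hm1 : ∫ x, |x| ∂(ν1 ∗ gaussianReal 0 1) ≤ m)
    (hi2 : Integrable (fun x => |x|) (ν2 ∗ gaussianReal 0 1))
    (hm2 : ∫ x, |x| ∂(ν2 ∗ gaussianReal 0 1) ≤ m)
    (ht : ∫ x, s x ∂(ν1 ∗ gaussianReal 0 1) - ∫ x, s x ∂(ν2 ∗ gaussianReal 0 1) = 2 * t)
    (hX : 0 < X) (hX1 : X < 1) (hXt : X ≤ t)
    (hTT : T ^ 2 = 12 * √Real.pi * X ^ 2 / R) (hm : m = R * X / 3) :
    √(2 * Real.pi) / 4 * (1 - X) ^ 2 * R / X + 3 / 8 * R ^ 2 * (24 / 10000 +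
      8 / (5 * √Real.pi) * q * (∫ u : ℝ, u ^ (2 * n) * Real.exp (-2 * u ^ 2)) *
      ((2 * n + 1) / 4 - R / (3 * √Real.pi * X ^ 2))) ≤ 2 / 9 := by
  have hpi : 0 < √Real.pi := by positivity
  have hq0 : 0 < √(2 * Real.pi) := by positivity
  have hR0 : 0 < R := by linarith
  have hpp : √Real.pi ^ 2 = Real.pi := Real.sq_sqrt Real.pi_pos.le
  have h1 := G_bound hs hs1 (l := 2 * X / R ^ 2) hR0 (by positivity) hq hq1 hT
  rw [← hpp, Real.sqrt_sq hpi.le] at h1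
  have hr : √(2 * Real.pi) / 2 * (1 - X) ≤ R := by nlinarith
  have h2 := slack_two hs hs1 hR0 (r := √(2 * Real.pi) / 2 * (1 - X))
    (mul_nonneg (by positivity) (by linarith)) hr hi1 hm1 hi2 hm2 ht
  refine core_alg hpi hR0 hX hTT (k := 2 * n + 1)
    (N := ∫ u : ℝ, u ^ (2 * n + 2) * Real.exp (-2 * u ^ 2)) ?_ hm h1 ?_
  · rw [gm_succ n (by norm_num)]; norm_num
  · have e : √(2 * Real.pi) / 2 * (1 - X) * (1 - X) - 1 / √(2 * Real.pi) *
      (√(2 * Real.pi) / 2 * (1 - X)) ^ 2 = √(2 * Real.pi) / 4 * (1 - X) ^ 2 := by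
      generalize √(2 * Real.pi) = a at *
      field_simp; ring
    rw [← e]
    generalize √(2 * Real.pi) / 2 * (1 - X) = r at *
    generalize 1 / √(2 * Real.pi) * r ^ 2 = w at *
    nlinarith

lemma psi_le {n : ℕ} (hn : n ≠ 0) {q : ℝ} (hq : 0 ≤ q) (h : q * n ^ n ≤ Real.exp 1 ^ n) (u : ℝ) :
    q * u ^ (2 * n) * Real.exp (-u ^ 2) ≤ 1 := by
  have hn0 : (0:ℝ) < n := by exact_mod_cast Nat.pos_of_ne_zero hn
  have h1 := Real.add_one_le_exp (u ^ 2 / n - 1)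
  have h2 : (u ^ 2 / n) ^ n ≤ Real.exp (u ^ 2 / n - 1) ^ n :=
    pow_le_pow_left₀ (by positivity) (by linarith) n
  have h3 : Real.exp (u ^ 2 / n - 1) ^ n * Real.exp 1 ^ n * Real.exp (-u ^ 2) = 1 := by
    rw [← mul_pow, ← Real.exp_add, ← Real.exp_nat_mul, ← Real.exp_add, Real.exp_eq_one_iff]
    field_simp; ring
  have h4 : u ^ (2 * n) = n ^ n * (u ^ 2 / n) ^ n := by
    rw [pow_mul, ← mul_pow]; congr 1; field_simp
  rw [h4]
  have hE := Real.exp_pos (-u ^ 2)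
  calc q * (n ^ n * (u ^ 2 / n) ^ n) * Real.exp (-u ^ 2)
      = (q * n ^ n) * (u ^ 2 / n) ^ n * Real.exp (-u ^ 2) := by ring
    _ ≤ Real.exp 1 ^ n * Real.exp (u ^ 2 / n - 1) ^ n * Real.exp (-u ^ 2) := by gcongr
    _ = 1 := by rw [mul_comm (Real.exp 1 ^ n)]; exact h3

lemma m0 : ∫ u : ℝ, u ^ (2 * 0) * Real.exp (-2 * u ^ 2) = √(Real.pi / 2) := gm_zero
lemma m2 : ∫ u : ℝ, u ^ (2 * 1) * Real.exp (-2 * u ^ 2) = 1 / 4 * √(Real.pi / 2) := by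
  have := gm_succ 0 (c := 2) (by norm_num)
  rw [m0] at this; rw [show 2 * 1 = 2 * 0 + 2 by norm_num, this]; norm_num
lemma m4 : ∫ u : ℝ, u ^ (2 * 2) * Real.exp (-2 * u ^ 2) = 3 / 16 * √(Real.pi / 2) := by
  have := gm_succ 1 (c := 2) (by norm_num)
  rw [m2] at this; rw [show 2 * 2 = 2 * 1 + 2 by norm_num, this]; push_cast; ring
lemma m6 : ∫ u : ℝ, u ^ (2 * 3) * Real.exp (-2 * u ^ 2) = 15 / 64 * √(Real.pi / 2) := by
  have := gm_succ 2 (c := 2) (by norm_num)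
  rw [m4] at this; rw [show 2 * 3 = 2 * 2 + 2 by norm_num, this]; push_cast; ring
lemma m8 : ∫ u : ℝ, u ^ (2 * 4) * Real.exp (-2 * u ^ 2) = 105 / 256 * √(Real.pi / 2) := by
  have := gm_succ 3 (c := 2) (by norm_num)
  rw [m6] at this; rw [show 2 * 4 = 2 * 3 + 2 by norm_num, this]; push_cast; ring
lemma m10 : ∫ u : ℝ, u ^ (2 * 5) * Real.exp (-2 * u ^ 2) = 945 / 1024 * √(Real.pi / 2) := by
  have := gm_succ 4 (c := 2) (by norm_num)
  rw [m8] at this; rw [show 2 * 5 = 2 * 4 + 2 by norm_num, this]; push_cast; ring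
lemma m12 : ∫ u : ℝ, u ^ (2 * 6) * Real.exp (-2 * u ^ 2) = 10395 / 4096 * √(Real.pi / 2) := by
  have := gm_succ 5 (c := 2) (by norm_num)
  rw [m10] at this; rw [show 2 * 6 = 2 * 5 + 2 by norm_num, this]; push_cast; ring

/-- numerical lower bound for the gain -/
lemma gain_lower {q d k a b R X M : ℝ} (hq : 0 ≤ q) (hd : 0 ≤ d) (hk : 0 ≤ k) (hR : 0 < R)
    (hX : 0 < X) (hM : M = d * √(Real.pi / 2))
    (ha : a ≤ 8 / 5 * q * d * 0.7071 * (k / 4))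
    (hb : 8 / 5 * q * d * 0.70711 / (3 * 1.77245) ≤ b) :
    a - b * (R / X ^ 2) ≤ 8 / (5 * √Real.pi) * q * M * (k / 4 - R / (3 * √Real.pi * X ^ 2)) := by
  have hp : 0 < √Real.pi := by positivity
  have hp1 : 1.77245 ≤ √Real.pi := by
    apply Real.le_sqrt_of_sq_le
    have := Real.pi_gt_d6
    norm_num at *; linarith
  have hs1 : √Real.pi * 0.7071 ≤ √(Real.pi / 2) := by
    apply Real.le_sqrt_of_sq_le
    rw [mul_pow, Real.sq_sqrt Real.pi_pos.le]; nlinarith [Real.pi_pos]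
  have hs2 : √(Real.pi / 2) ≤ √Real.pi * 0.70711 := by
    rw [Real.sqrt_le_left (by positivity), mul_pow, Real.sq_sqrt Real.pi_pos.le]
    nlinarith [Real.pi_pos]
  set c := √(Real.pi / 2) / √Real.pi with hc
  have hc1 : 0.7071 ≤ c := by rw [hc, le_div_iff₀ hp]; linarith
  have hc2 : c ≤ 0.70711 := by rw [hc, div_le_iff₀ hp]; linarith
  have e : 8 / (5 * √Real.pi) * q * M * (k / 4 - R / (3 * √Real.pi * X ^ 2))
     = 8 / 5 * q * d * c * (k / 4) - 8 / 5 * q * d * c / (3 * √Real.pi) * (R / X ^ 2) := by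
    rw [hM, hc]; field_simp
  rw [e]
  have i1 : 8 / 5 * q * d * 0.7071 * (k / 4) ≤ 8 / 5 * q * d * c * (k / 4) := by gcongr
  have i2 : 8 / 5 * q * d * c / (3 * √Real.pi) ≤ 8 / 5 * q * d * 0.70711 / (3 * 1.77245) := by
    gcongr
  have i3 : 8 / 5 * q * d * c / (3 * √Real.pi) * (R / X ^ 2) ≤ b * (R / X ^ 2) :=
    mul_le_mul_of_nonneg_right (i2.trans hb) (by positivity)
  linarith

lemma num_step {R X R0 R1 X0 a b : ℝ} (hR0 : 0 < R0) (hX0 : 0 < X0) (hX01 : X0 < 1) (hb : 0 ≤ b)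
    (hX : 0 < X) (hX1 : X < 1)
    (h1 : R0 ≤ R) (h2 : R ≤ R1)
    (f0 : 0.6266 * (1 - X) ^ 2 * R / X + 3 / 8 * R ^ 2 * (24 / 10000) ≤ 2 / 9)
    (f1 : 3 / 8 * R ^ 2 * (24 / 10000 + (a - b * (R / X ^ 2))) ≤ 2 / 9)
    (n0 : 2 / 9 * X0 < 0.6266 * (1 - X0) ^ 2 * R0 + 3 / 8 * R0 ^ 2 * (24 / 10000) * X0)
    (n1 : 2 / 9 < 3 / 8 * R0 ^ 2 * (24 / 10000 + (a - b * (R1 / X0 ^ 2)))) : False := by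
  have hRp : 0 < R := by linarith
  have hXp : 0 ≤ 1 - X0 := by linarith
  rcases le_total X X0 with h | h
  · have a1 : 0.6266 * (1 - X0) ^ 2 * R0 / X0 ≤ 0.6266 * (1 - X) ^ 2 * R / X := by
      gcongr
    have a2 : 3 / 8 * R0 ^ 2 * (24 / 10000) ≤ 3 / 8 * R ^ 2 * (24 / 10000) := by gcongr
    have a3 : 0.6266 * (1 - X0) ^ 2 * R0 / X0 + 3 / 8 * R0 ^ 2 * (24 / 10000) ≤ 2 / 9 := by linarith
    have a4 := mul_le_mul_of_nonneg_right a3 hX0.le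
    rw [add_mul, div_mul_cancel₀ _ hX0.ne'] at a4
    linarith
  · have hR1 : 0 < R1 := by linarith
    have a1 : R / X ^ 2 ≤ R1 / X0 ^ 2 := by gcongr
    have a2 : 24 / 10000 + (a - b * (R1 / X0 ^ 2)) ≤ 24 / 10000 + (a - b * (R / X ^ 2)) := by
      have := mul_le_mul_of_nonneg_left a1 hb
      linarith
    have a0 : 0 < 24 / 10000 + (a - b * (R1 / X0 ^ 2)) := by
      by_contra h'
      push Not at h'
      have : 3 / 8 * R0 ^ 2 * (24 / 10000 + (a - b * (R1 / X0 ^ 2))) ≤ 0 :=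
        mul_nonpos_of_nonneg_of_nonpos (by positivity) h'
      linarith
    have a3 : 3 / 8 * R0 ^ 2 * (24 / 10000 + (a - b * (R1 / X0 ^ 2))) ≤
      3 / 8 * R ^ 2 * (24 / 10000 + (a - b * (R / X ^ 2))) := by
      apply mul_le_mul _ a2 a0.le (by positivity)
      gcongr
    linarith

lemma num_final {R X : ℝ} (hX : 0 < X) (hX1 : X < 1) (hR : 1.87 ≤ R)
    (f0 : 0.6266 * (1 - X) ^ 2 * R / X + 3 / 8 * R ^ 2 * (24 / 10000) ≤ 2 / 9)
    (f3 : 3 / 8 * R ^ 2 * (24 / 10000 + (0.3451 - 0.03711 * (R / X ^ 2))) ≤ 2 / 9)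
    (f4 : 3 / 8 * R ^ 2 * (24 / 10000 + (0.2226 - 0.01862 * (R / X ^ 2))) ≤ 2 / 9)
    (f6 : 3 / 8 * R ^ 2 * (24 / 10000 + (0.08066 - 0.00467 * (R / X ^ 2))) ≤ 2 / 9) : False := by
  rcases le_total R 2.01 with h | h0
  · exact num_step (R0 := 1.87) (R1 := 2.01) (X0 := 0.65) (by norm_num) (by norm_num)
      (by norm_num) (by norm_num) hX hX1 hR h f0 f3 (by norm_num) (by norm_num)
  rcases le_total R 2.34 with h | h1
  · exact num_step (R0 := 2.01) (R1 := 2.34) (X0 := 0.66) (by norm_num) (by norm_num)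
      (by norm_num) (by norm_num) hX hX1 h0 h f0 f3 (by norm_num) (by norm_num)
  rcases le_total R 2.97 with h | h2
  · exact num_step (R0 := 2.34) (R1 := 2.97) (X0 := 0.68) (by norm_num) (by norm_num)
      (by norm_num) (by norm_num) hX hX1 h1 h f0 f3 (by norm_num) (by norm_num)
  rcases le_total R 4.26 with h | h3
  · exact num_step (R0 := 2.97) (R1 := 4.26) (X0 := 0.71) (by norm_num) (by norm_num)
      (by norm_num) (by norm_num) hX hX1 h2 h f0 f4 (by norm_num) (by norm_num)
  rcases le_total R 6.05 with h | h4
  · exact num_step (R0 := 4.26) (R1 := 6.05) (X0 := 0.75) (by norm_num) (by norm_num)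
      (by norm_num) (by norm_num) hX hX1 h3 h f0 f6 (by norm_num) (by norm_num)
  rcases le_total R 9.14 with h | h5
  · exact num_step (R0 := 6.05) (R1 := 9.14) (X0 := 0.8) (by norm_num) (by norm_num)
      (by norm_num) (by norm_num) hX hX1 h4 h f0 f6 (by norm_num) (by norm_num)
  rcases le_total R 11.73 with h | h6
  · exact num_step (R0 := 9.14) (R1 := 11.73) (X0 := 0.85) (by norm_num) (by norm_num)
      (by norm_num) (by norm_num) hX hX1 h5 h f0 f6 (by norm_num) (by norm_num)
  rcases le_total R 13.33 with h | h7
  · exact num_step (R0 := 11.73) (R1 := 13.33) (X0 := 0.89) (by norm_num) (by norm_num)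
      (by norm_num) (by norm_num) hX hX1 h6 h f0 f6 (by norm_num) (by norm_num)
  rcases le_total R 14.11 with h | h8
  · exact num_step (R0 := 13.33) (R1 := 14.11) (X0 := 0.91) (by norm_num) (by norm_num)
      (by norm_num) (by norm_num) hX hX1 h7 h f0 f6 (by norm_num) (by norm_num)
  rcases le_total R 14.8 with h | h9
  · exact num_step (R0 := 14.11) (R1 := 14.8) (X0 := 0.93) (by norm_num) (by norm_num)
      (by norm_num) (by norm_num) hX hX1 h8 h f0 f6 (by norm_num) (by norm_num)
  rcases le_total R 15.18 with h | h10
  · exact num_step (R0 := 14.8) (R1 := 15.18) (X0 := 0.94) (by norm_num) (by norm_num)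
      (by norm_num) (by norm_num) hX hX1 h9 h f0 f6 (by norm_num) (by norm_num)
  rcases le_total R 15.85 with h | h11
  · exact num_step (R0 := 15.18) (R1 := 15.85) (X0 := 0.96) (by norm_num) (by norm_num)
      (by norm_num) (by norm_num) hX hX1 h10 h f0 f6 (by norm_num) (by norm_num)
  rcases le_total R 16.02 with h | h12
  · exact num_step (R0 := 15.85) (R1 := 16.02) (X0 := 0.97) (by norm_num) (by norm_num)
      (by norm_num) (by norm_num) hX hX1 h11 h f0 f6 (by norm_num) (by norm_num)
  have a1 : 0 ≤ 0.6266 * (1 - X) ^ 2 * R / X := by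
    have : 0 ≤ R := by linarith
    positivity
  nlinarith

lemma core {ν1 ν2 : Measure ℝ} [IsProbabilityMeasure ν1] [IsProbabilityMeasure ν2]
    {T X m : ℝ}
    (hT : ∀ u, ‖charFn ν1 u - charFn ν2 u‖ ≤ T * |u|)
    (hi1 : Integrable (fun x => |x|) (ν1 ∗ gaussianReal 0 1))
    (hm1 : ∫ x, |x| ∂(ν1 ∗ gaussianReal 0 1) ≤ m)
    (hi2 : Integrable (fun x => |x|) (ν2 ∗ gaussianReal 0 1))
    (hm2 : ∫ x, |x| ∂(ν2 ∗ gaussianReal 0 1) ≤ m)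
    (hX : 0 < X) (hXT : X ^ 3 * (4 * √Real.pi) = m * T ^ 2) {A : Set ℝ} (hA : MeasurableSet A) :
    ((ν1 ∗ gaussianReal 0 1) A).toReal - ((ν2 ∗ gaussianReal 0 1) A).toReal ≤ X := by
  rcases le_or_gt 1 X with hX1 | hX1
  · have h1 : ((ν1 ∗ gaussianReal 0 1) A).toReal ≤ 1 := measureReal_le_one
    have h2 : 0 ≤ ((ν2 ∗ gaussianReal 0 1) A).toReal := ENNReal.toReal_nonneg
    linarith
  by_contra hcon
  push Not at hcon
  set t := ((ν1 ∗ gaussianReal 0 1) A).toReal - ((ν2 ∗ gaussianReal 0 1) A).toReal with ht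
  classical
  set s : ℝ → ℝ := fun x => 2 * A.indicator 1 x - 1 with hsdef
  have hs : Measurable s := by
    have : Measurable (A.indicator (1 : ℝ → ℝ)) := measurable_one.indicator hA
    fun_prop
  have hs1 : ∀ x, s x = 1 ∨ s x = -1 := by
    intro x
    by_cases h : x ∈ A
    · left; simp [hsdef, h]; norm_num
    · right; simp [hsdef, h]
  have hsi : ∀ μ : Measure ℝ, IsProbabilityMeasure μ → ∫ x, s x ∂μ = 2 * (μ A).toReal - 1 := by
    intro μ hμ
    have hi : Integrable (A.indicator (1 : ℝ → ℝ)) μ :=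
      (integrable_const (1:ℝ)).indicator hA
    rw [hsdef, integral_sub (hi.const_mul 2) (integrable_const 1), integral_const_mul,
      integral_indicator_one hA]
    simp [measureReal_def]
  have hst : ∫ x, s x ∂(ν1 ∗ gaussianReal 0 1) - ∫ x, s x ∂(ν2 ∗ gaussianReal 0 1) = 2 * t := by
    rw [hsi _ inferInstance, hsi _ inferInstance, ht]; ring
  have hml := mean_lower hi1 hm1
  have hq0 : 2.5064 ≤ √(2 * Real.pi) := by
    apply Real.le_sqrt_of_sq_le
    have := Real.pi_gt_d6
    norm_num at *; linarith
  have hm0 : 0 < m := by linarith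
  obtain ⟨R, hRdef⟩ : ∃ R, R = 3 * m / X := ⟨_, rfl⟩
  have hRm : 3 * m ≤ R := by rw [hRdef, le_div_iff₀ hX]; nlinarith
  have hR : √(2 * Real.pi) / 2 ≤ R := by linarith
  have hR87 : 1.87 ≤ R := by linarith
  have hmR : m = R * X / 3 := by rw [hRdef]; field_simp
  have hR0 : 0 < R := by linarith
  have hTT : T ^ 2 = 12 * √Real.pi * X ^ 2 / R := by
    rw [hRdef]; field_simp
    linarith
  have hE := Real.exp_one_gt_d9
  have key : ∀ (n : ℕ) (q : ℝ), n ≠ 0 → 0 ≤ q → q * n ^ n ≤ 2.7182818283 ^ n →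
    √(2 * Real.pi) / 4 * (1 - X) ^ 2 * R / X + 3 / 8 * R ^ 2 * (24 / 10000 +
      8 / (5 * √Real.pi) * q * (∫ u : ℝ, u ^ (2 * n) * Real.exp (-2 * u ^ 2)) *
      ((2 * n + 1) / 4 - R / (3 * √Real.pi * X ^ 2))) ≤ 2 / 9 := by
    intro n q hn hq hqn
    refine core_ineq hs hs1 hR hq (psi_le hn hq (hqn.trans ?_)) hT hi1 hm1 hi2 hm2 hst hX hX1
      hcon.le hTT hmR
    gcongr
  have hpos : 0 ≤ √(2 * Real.pi) / 4 * (1 - X) ^ 2 * R / X := by positivity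
  have hgen : ∀ (n : ℕ) (q d a b : ℝ), n ≠ 0 → 0 ≤ q → 0 ≤ d → q * n ^ n ≤ 2.7182818283 ^ n →
      ∫ u : ℝ, u ^ (2 * n) * Real.exp (-2 * u ^ 2) = d * √(Real.pi / 2) →
      a ≤ 8 / 5 * q * d * 0.7071 * ((2 * n + 1) / 4) →
      8 / 5 * q * d * 0.70711 / (3 * 1.77245) ≤ b →
      3 / 8 * R ^ 2 * (24 / 10000 + (a - b * (R / X ^ 2))) ≤ 2 / 9 := by
    intro n q d a b hn hq hd hqn hM ha hb
    have h1 := key n q hn hq hqn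
    have h2 := gain_lower hq hd (k := 2 * n + 1) (by positivity) hR0 hX hM ha hb
    have h3 : 3 / 8 * R ^ 2 * (24 / 10000 + (a - b * (R / X ^ 2))) ≤ 3 / 8 * R ^ 2 * (24 / 10000 +
      8 / (5 * √Real.pi) * q * (∫ u : ℝ, u ^ (2 * n) * Real.exp (-2 * u ^ 2)) *
      ((2 * n + 1) / 4 - R / (3 * √Real.pi * X ^ 2))) := by gcongr
    linarith
  refine num_final hX hX1 hR87 ?_
    (hgen 3 0.7439 (15 / 64) _ _ (by norm_num) (by norm_num) (by norm_num) (by norm_num) m6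
      (by norm_num) (by norm_num))
    (hgen 4 0.21327 (105 / 256) _ _ (by norm_num) (by norm_num) (by norm_num) (by norm_num) m8
      (by norm_num) (by norm_num))
    (hgen 6 0.0086468 (10395 / 4096) _ _ (by norm_num) (by norm_num) (by norm_num) (by norm_num) m12
      (by norm_num) (by norm_num))
  have h0 := key 1 0 one_ne_zero le_rfl (by norm_num)
  simp only [mul_zero, zero_mul, add_zero] at h0
  refine le_trans ?_ h0
  gcongr
  linarith

lemma charFn_eq (μ : Measure ℝ) (u : ℝ) : charFn μ u = charFun μ u := by
  rw [charFun_apply_real]; unfold charFn; simp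

lemma scale_conv {μ ν : Measure ℝ} [IsProbabilityMeasure μ] [IsProbabilityMeasure ν] {a : ℝ}
    (ha : 0 < a) (h : ∀ u : ℝ, charFn μ u = charFn ν u * Complex.exp ((-(a ^ 2 * u ^ 2 / 2) : ℝ))) :
    μ.map (a⁻¹ * ·) = (ν.map (a⁻¹ * ·)) ∗ gaussianReal 0 1 := by
  have hm : Measurable (a⁻¹ * · : ℝ → ℝ) := by fun_prop
  haveI : IsProbabilityMeasure (μ.map (a⁻¹ * ·)) := Measure.isProbabilityMeasure_map hm.aemeasurable
  haveI : IsProbabilityMeasure (ν.map (a⁻¹ * ·)) := Measure.isProbabilityMeasure_map hm.aemeasurable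
  apply Measure.ext_of_charFun
  ext u
  rw [charFun_conv, charFun_map_mul, charFun_map_mul, charFun_gaussianReal, ← charFn_eq, h,
    ← charFn_eq]
  congr 2
  push_cast
  have : (a : ℂ) ≠ 0 := by exact_mod_cast ha.ne'
  simp only [mul_zero, zero_mul, zero_sub, one_mul]
  field_simp

lemma core_scaled {μ1 μ2 ν1 ν2 : Measure ℝ} [IsProbabilityMeasure μ1] [IsProbabilityMeasure μ2]
    [IsProbabilityMeasure ν1] [IsProbabilityMeasure ν2] {a T X m : ℝ} (ha : 0 < a)
    (h1 : ∀ u : ℝ, charFn μ1 u = charFn ν1 u * Complex.exp ((-(a ^ 2 * u ^ 2 / 2) : ℝ)))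
    (h2 : ∀ u : ℝ, charFn μ2 u = charFn ν2 u * Complex.exp ((-(a ^ 2 * u ^ 2 / 2) : ℝ)))
    (hT : ∀ u, ‖charFn ν1 u - charFn ν2 u‖ ≤ T * |u|)
    (hi1 : Integrable (fun x => |x|) μ1) (hm1 : ∫ x, |x| ∂μ1 ≤ m)
    (hi2 : Integrable (fun x => |x|) μ2) (hm2 : ∫ x, |x| ∂μ2 ≤ m)
    (hX : 0 < X) (hXT : X ^ 3 * (4 * √Real.pi) * a ^ 3 = m * T ^ 2)
    {A : Set ℝ} (hA : MeasurableSet A) :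
    (μ1 A).toReal - (μ2 A).toReal ≤ X := by
  have hm : Measurable (a⁻¹ * · : ℝ → ℝ) := by fun_prop
  haveI : IsProbabilityMeasure (ν1.map (a⁻¹ * ·)) := Measure.isProbabilityMeasure_map hm.aemeasurable
  haveI : IsProbabilityMeasure (ν2.map (a⁻¹ * ·)) := Measure.isProbabilityMeasure_map hm.aemeasurable
  have e1 := scale_conv ha h1
  have e2 := scale_conv ha h2
  have hB : MeasurableSet ((a * · : ℝ → ℝ) ⁻¹' A) := (by fun_prop : Measurable (a * · : ℝ → ℝ)) hA
  have hpre : (a⁻¹ * · : ℝ → ℝ) ⁻¹' ((a * · : ℝ → ℝ) ⁻¹' A) = A := by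
    ext x; simp [mul_inv_cancel_left₀ ha.ne']
  have hitg : ∀ μ : Measure ℝ, Integrable (fun x => |x|) μ →
      Integrable (fun x => |x|) (μ.map (a⁻¹ * ·)) := by
    intro μ hi
    rw [integrable_map_measure (by fun_prop) hm.aemeasurable]
    refine (hi.const_mul a⁻¹).congr (Filter.Eventually.of_forall fun x => ?_)
    simp [abs_mul, abs_of_pos ha]
  have hval : ∀ μ : Measure ℝ, ∫ x, |x| ∂μ ≤ m → ∫ x, |x| ∂(μ.map (a⁻¹ * ·)) ≤ a⁻¹ * m := by
    intro μ hi
    rw [integral_map hm.aemeasurable (by fun_prop)]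
    simp only [abs_mul, abs_inv, abs_of_pos ha]
    rw [integral_const_mul]
    gcongr
  have hc := core (ν1 := ν1.map (a⁻¹ * ·)) (ν2 := ν2.map (a⁻¹ * ·)) (T := a⁻¹ * T) (X := X)
    (m := a⁻¹ * m) ?_ (e1 ▸ hitg _ hi1) (e1 ▸ hval _ hm1) (e2 ▸ hitg _ hi2) (e2 ▸ hval _ hm2) hX ?_ hB
  · rw [← e1, ← e2, Measure.map_apply hm hB, Measure.map_apply hm hB, hpre] at hc
    exact hc
  · intro u
    rw [charFn_eq, charFn_eq, charFun_map_mul, charFun_map_mul, ← charFn_eq, ← charFn_eq]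
    refine (hT _).trans (le_of_eq ?_)
    rw [abs_mul, abs_inv, abs_of_pos ha]; ring
  · have : X ^ 3 * (4 * √Real.pi) = m * T ^ 2 / a ^ 3 := by rw [← hXT]; field_simp
    rw [this]; field_simp

lemma charFn_factor {t b σ Sg u : ℝ} {I z w : ℂ} (ht : 0 < t)
    (h1 : z = Complex.exp ((t : ℂ) *
      ((u * b : ℝ) * Complex.I + ((-(u ^ 2 * σ ^ 2) / 2 : ℝ) : ℂ) + I)))
    (h2 : w = Complex.exp ((t : ℂ) *
      ((u * b : ℝ) * Complex.I + ((-(u ^ 2 * (σ ^ 2 - Sg ^ 2)) / 2 : ℝ) : ℂ) + I))) :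
    z = w * Complex.exp ((-((Sg * √t) ^ 2 * u ^ 2 / 2) : ℝ)) := by
  rw [h1, h2, ← Complex.exp_add]
  congr 1
  rw [mul_pow, Real.sq_sqrt ht.le]
  push_cast
  ring

lemma toscani_le {μ ν : Measure ℝ} [IsProbabilityMeasure μ] [IsProbabilityMeasure ν]
    (h : toscani 1 μ ν ≠ ⊤) (u : ℝ) :
    ‖charFn μ u - charFn ν u‖ ≤ (toscani 1 μ ν).toReal * |u| := by
  by_cases hu : u = 0
  · subst hu
    simp [charFn]
  · have h1 : ENNReal.ofReal (‖charFn μ u - charFn ν u‖ / |u| ^ (1:ℝ)) ≤ toscani 1 μ ν :=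
      le_iSup (fun u : {u : ℝ // u ≠ 0} =>
        ENNReal.ofReal (‖charFn μ u.1 - charFn ν u.1‖ / |u.1| ^ (1:ℝ))) ⟨u, hu⟩
    rw [ENNReal.ofReal_le_iff_le_toReal h, Real.rpow_one, div_le_iff₀ (abs_pos.2 hu)] at h1
    exact h1


/-- Total variation bound between Lévy marginals with positive Gaussian
part via the Toscani–Fourier distance of the same processes with reduced Gaussian part. -/
theorem statement19 (b1 b2 σ1 σ2 : ℝ) (hσ1 : 0 < σ1) (hσ2 : 0 < σ2)
    (ν1 ν2 : Measure ℝ) (hν10 : ν1 {0} = 0) (hν20 : ν2 {0} = 0)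
    (hν1levy : ∫⁻ x, ENNReal.ofReal (min (x ^ 2) 1) ∂ν1 ≠ ⊤)
    (hν2levy : ∫⁻ x, ENNReal.ofReal (min (x ^ 2) 1) ∂ν2 ≠ ⊤)
    (t : ℝ) (ht : 0 < t)
    (Sg : ℝ) (hSg0 : 0 < Sg) (hSg : Sg < min σ1 σ2)
    (μt1 μt2 μs1 μs2 : Measure ℝ)
    (hμt1P : IsProbabilityMeasure μt1) (hμt2P : IsProbabilityMeasure μt2)
    (hμs1P : IsProbabilityMeasure μs1) (hμs2P : IsProbabilityMeasure μs2)
    (hμt1 : ∀ u : ℝ, charFn μt1 u = Complex.exp ((t : ℂ) *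
      ((u * b1 : ℝ) * Complex.I + ((-(u ^ 2 * σ1 ^ 2) / 2 : ℝ) : ℂ)
        + ∫ x, lkIntegrand u x ∂ν1)))
    (hμt2 : ∀ u : ℝ, charFn μt2 u = Complex.exp ((t : ℂ) *
      ((u * b2 : ℝ) * Complex.I + ((-(u ^ 2 * σ2 ^ 2) / 2 : ℝ) : ℂ)
        + ∫ x, lkIntegrand u x ∂ν2)))
    (hμs1 : ∀ u : ℝ, charFn μs1 u = Complex.exp ((t : ℂ) *
      ((u * b1 : ℝ) * Complex.I + ((-(u ^ 2 * (σ1 ^ 2 - Sg ^ 2)) / 2 : ℝ) : ℂ)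
        + ∫ x, lkIntegrand u x ∂ν1)))
    (hμs2 : ∀ u : ℝ, charFn μs2 u = Complex.exp ((t : ℂ) *
      ((u * b2 : ℝ) * Complex.I + ((-(u ^ 2 * (σ2 ^ 2 - Sg ^ 2)) / 2 : ℝ) : ℂ)
        + ∫ x, lkIntegrand u x ∂ν2)))
    (hm1 : Integrable (fun x : ℝ => |x|) μt1) (hm2 : Integrable (fun x : ℝ => |x|) μt2)
    (m1 m2 : ℝ) (hm1v : m1 = ∫ x, |x| ∂μt1) (hm2v : m2 = ∫ x, |x| ∂μt2) :
    ENNReal.ofReal (tvDist μt1 μt2)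
      ≤ ENNReal.ofReal ((max m1 m2) ^ ((1 : ℝ) / 3)) * toscani 1 μs1 μs2 ^ ((2 : ℝ) / 3)
        / ENNReal.ofReal ((16 * Real.pi) ^ ((1 : ℝ) / 6) * Sg * Real.sqrt t) := by
  have hst : 0 < √t := Real.sqrt_pos.2 ht
  have ha : 0 < Sg * √t := mul_pos hSg0 hst
  have c1 := fun u => charFn_factor (Sg := Sg) ht (hμt1 u) (hμs1 u)
  have c2 := fun u => charFn_factor (Sg := Sg) ht (hμt2 u) (hμs2 u)
  have hM0 : 0 < max m1 m2 := by
    refine lt_max_of_lt_left ?_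
    have hm : Measurable ((Sg * √t)⁻¹ * · : ℝ → ℝ) := by fun_prop
    have : IsProbabilityMeasure (μs1.map ((Sg * √t)⁻¹ * ·)) :=
      Measure.isProbabilityMeasure_map hm.aemeasurable
    have e1 := scale_conv ha c1
    have hi : Integrable (fun x => |x|) (μt1.map ((Sg * √t)⁻¹ * ·)) := by
      rw [integrable_map_measure (by fun_prop) hm.aemeasurable]
      refine (hm1.const_mul (Sg * √t)⁻¹).congr (Filter.Eventually.of_forall fun x => ?_)
      show (Sg * √t)⁻¹ * |x| = |(Sg * √t)⁻¹ * x|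
      rw [abs_mul, abs_of_pos (inv_pos.2 ha)]
    have h := mean_lower (e1 ▸ hi) le_rfl
    rw [← e1, integral_map hm.aemeasurable (by fun_prop)] at h
    simp only [abs_mul (Sg * √t)⁻¹, abs_of_pos (inv_pos.2 ha)] at h
    rw [integral_const_mul, ← hm1v] at h
    have hp : 0 < √(2 * Real.pi) / 4 := by positivity
    exact pos_of_mul_pos_right (hp.trans_le h) (inv_pos.2 ha).le
  set D := (16 * Real.pi) ^ ((1 : ℝ) / 6) * Sg * √t with hD
  have hD0 : 0 < D := by positivity
  by_cases htop : toscani 1 μs1 μs2 = ⊤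
  · rw [htop, ENNReal.top_rpow_of_pos (by norm_num), ENNReal.mul_top, ENNReal.top_div_of_ne_top]
    · exact le_top
    · exact ENNReal.ofReal_ne_top
    · rw [Ne, ENNReal.ofReal_eq_zero, not_le]
      positivity
  have hT := toscani_le htop
  by_cases hzero : toscani 1 μs1 μs2 = 0
  · have heq : μt1 = μt2 := by
      apply Measure.ext_of_charFun
      ext u
      rw [← charFn_eq, ← charFn_eq, c1, c2]
      have := hT u
      rw [hzero, ENNReal.toReal_zero, zero_mul] at this
      rw [sub_eq_zero.1 (norm_le_zero_iff.1 this)]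
    rw [heq]
    simp [tvDist]
  set T := (toscani 1 μs1 μs2).toReal with hTdef
  have hT0 : 0 < T := ENNReal.toReal_pos hzero htop
  set X := (max m1 m2) ^ ((1 : ℝ) / 3) * T ^ ((2 : ℝ) / 3) / D with hXdef
  have hX0 : 0 < X := by positivity
  have hrhs : ENNReal.ofReal ((max m1 m2) ^ ((1 : ℝ) / 3)) * toscani 1 μs1 μs2 ^ ((2 : ℝ) / 3)
        / ENNReal.ofReal D = ENNReal.ofReal X := by
    rw [← ENNReal.ofReal_toReal htop, ← hTdef, ENNReal.ofReal_rpow_of_pos hT0,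
      ← ENNReal.ofReal_mul (by positivity), ← ENNReal.ofReal_div_of_pos hD0]
  rw [hrhs]
  apply ENNReal.ofReal_le_ofReal
  have hXT : X ^ 3 * (4 * √Real.pi) * (Sg * √t) ^ 3 = max m1 m2 * T ^ 2 := by
    have a1 : ((max m1 m2) ^ ((1 : ℝ) / 3)) ^ 3 = max m1 m2 := by
      rw [← Real.rpow_natCast, ← Real.rpow_mul hM0.le]; norm_num
    have a2 : (T ^ ((2 : ℝ) / 3)) ^ 3 = T ^ 2 := by
      rw [← Real.rpow_natCast, ← Real.rpow_mul hT0.le]; norm_num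
    have a3 : ((16 * Real.pi) ^ ((1 : ℝ) / 6)) ^ 3 = 4 * √Real.pi := by
      rw [← Real.rpow_natCast, ← Real.rpow_mul (by positivity)]
      rw [show (1 : ℝ) / 6 * ((3 : ℕ) : ℝ) = 1 / 2 by norm_num, ← Real.sqrt_eq_rpow,
        show 16 * Real.pi = 4 ^ 2 * Real.pi by norm_num, Real.sqrt_mul (by positivity),
        Real.sqrt_sq (by norm_num)]
    have hDD : D = (16 * Real.pi) ^ ((1 : ℝ) / 6) * (Sg * √t) := by rw [hD, mul_assoc]
    rw [hXdef, div_pow, mul_pow, a1, a2, hDD, mul_pow, a3]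
    field_simp
  have hT' : ∀ u, ‖charFn μs2 u - charFn μs1 u‖ ≤ T * |u| := fun u => by
    rw [norm_sub_rev]; exact hT u
  have b1 : ∫ x, |x| ∂μt1 ≤ max m1 m2 := hm1v ▸ le_max_left _ _
  have b2 : ∫ x, |x| ∂μt2 ≤ max m1 m2 := hm2v ▸ le_max_right _ _
  unfold tvDist
  haveI : Nonempty {A : Set ℝ // MeasurableSet A} := ⟨⟨∅, MeasurableSet.empty⟩⟩
  refine ciSup_le fun A => abs_le.2 ⟨?_, ?_⟩
  · have := core_scaled ha c2 c1 hT' hm2 b2 hm1 b1 hX0 hXT A.2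
    linarith
  · exact core_scaled ha c1 c2 hT hm1 b1 hm2 b2 hX0 hXT A.2
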